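/- arXiv:2605.07431 — 3 statements merged into one kernel-verified Lean document; each statement's English description precedes it below -/
import Mathlib

section
/- Let α, β₁, β₂, γ₁, γ₂ ∈ ℂ with γ₁ and γ₂ not non-positive integers. The Appell double series F(x,y) = ∑_{m,n≥0} ((α)_{m+n} (β₁)_m (β₂)_n / ((γ₁)_m (γ₂)_n m! n!)) x^m y^n converges absolutely on the domain D = {(x,y) ∈ ℂ² : |x| + |y| < 1}, defines a holomorphic function of (x,y) there, and satisfies on D the first Appell F₂ partial differential equation: x(1−x) ∂²F/∂x² − x y ∂²F/∂x∂y + (γ₁ − (α+β₁+1)x) ∂F/∂x − β₁ y ∂F/∂y − α β₁ F = 0. -/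
/-- The Pochhammer symbol (rising factorial) `(a)_n = a (a+1) ⋯ (a+n-1)`. -/
noncomputable def pochC (a : ℂ) (n : ℕ) : ℂ := ∏ i ∈ Finset.range n, (a + i)

/-- The `(m,n)`-term of the Appell `F₂` double series. -/
noncomputable def appellTermC (α β₁ β₂ γ₁ γ₂ x y : ℂ) (p : ℕ × ℕ) : ℂ :=
  pochC α (p.1 + p.2) * pochC β₁ p.1 * pochC β₂ p.2 /
      (pochC γ₁ p.1 * pochC γ₂ p.2 * p.1.factorial * p.2.factorial) *
    x ^ p.1 * y ^ p.2

/-- The Appell hypergeometric function `F₂(α; β₁, β₂; γ₁, γ₂ | x, y)`. -/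
noncomputable def appellF2C (α β₁ β₂ γ₁ γ₂ x y : ℂ) : ℂ :=
  ∑' p : ℕ × ℕ, appellTermC α β₁ β₂ γ₁ γ₂ x y p

/-- Partial derivative in the first variable. -/
noncomputable def dX (F : ℂ → ℂ → ℂ) (x y : ℂ) : ℂ := deriv (fun x' => F x' y) x

/-- Partial derivative in the second variable. -/
noncomputable def dY (F : ℂ → ℂ → ℂ) (x y : ℂ) : ℂ := deriv (fun y' => F x y') y


/-- Coefficients with at most polynomial times binomial growth. -/
def GoodCoeff (c : ℕ × ℕ → ℂ) : Prop :=
  ∃ (C : ℝ) (K : ℕ), 0 ≤ C ∧ ∀ m n : ℕ,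
    ‖c (m, n)‖ ≤ C * ((m + n + 1 : ℕ) : ℝ) ^ K * ((m + n).choose m : ℝ)

theorem summable_succ_pow_geom (K : ℕ) (q : ℝ) (h0 : 0 ≤ q) (h1 : q < 1) :
    Summable fun N : ℕ => ((N + 1 : ℕ) : ℝ) ^ K * q ^ N := by
  obtain ⟨t, ht, ht1⟩ := exists_between h1
  have htp : 0 < t := lt_of_le_of_lt h0 ht
  have h := summable_pow_mul_geometric_of_norm_lt_one K
    (r := t) (by rw [Real.norm_of_nonneg htp.le]; exact ht1)
  have h2 := ((summable_nat_add_iff 1).2 h).mul_left t⁻¹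
  refine Summable.of_nonneg_of_le (fun N => by positivity) (fun N => ?_) h2
  have : q ^ N ≤ t ^ N := pow_le_pow_left₀ h0 ht.le N
  calc ((N + 1 : ℕ) : ℝ) ^ K * q ^ N ≤ ((N + 1 : ℕ) : ℝ) ^ K * t ^ N := by gcongr
    _ = _ := by rw [pow_succ]; field_simp

theorem summable_binom (K : ℕ) (r s : ℝ) (hr : 0 ≤ r) (hs : 0 ≤ s) (h : r + s < 1) :
    Summable fun p : ℕ × ℕ => ((p.1 + p.2 + 1 : ℕ) : ℝ) ^ K * ((p.1 + p.2).choose p.1 : ℝ)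
      * (r ^ p.1 * s ^ p.2) := by
  rw [← (Finset.HasAntidiagonal.sigmaAntidiagonalEquivProd (A := ℕ)).summable_iff]
  rw [summable_sigma_of_nonneg (fun _ => by simp only [Function.comp]; positivity)]
  refine ⟨fun N => (hasSum_fintype _).summable, ?_⟩
  refine (summable_succ_pow_geom K (r + s) (by positivity) h).congr fun N => ?_
  rw [tsum_fintype, (Commute.all r s).add_pow']
  simp only [Function.comp, Finset.HasAntidiagonal.sigmaAntidiagonalEquivProd_apply]
  rw [Finset.univ_eq_attach, Finset.mul_sum, ← Finset.sum_attach]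
  refine Finset.sum_congr rfl fun p _ => ?_
  have hp := Finset.HasAntidiagonal.mem_antidiagonal.1 p.2
  rw [hp, nsmul_eq_mul]
  ring

theorem GoodCoeff.summable {c : ℕ × ℕ → ℂ} (hc : GoodCoeff c) {r s : ℝ} (hr : 0 ≤ r)
    (hs : 0 ≤ s) (h : r + s < 1) :
    Summable fun p : ℕ × ℕ => ‖c p‖ * (r ^ p.1 * s ^ p.2) := by
  obtain ⟨C, K, hC, hb⟩ := hc
  refine Summable.of_nonneg_of_le (fun p => by positivity) (fun p => ?_)
    ((summable_binom K r s hr hs h).mul_left C)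
  have := hb p.1 p.2
  calc ‖c p‖ * (r ^ p.1 * s ^ p.2) ≤
      (C * ((p.1 + p.2 + 1 : ℕ) : ℝ) ^ K * ((p.1 + p.2).choose p.1 : ℝ)) * (r ^ p.1 * s ^ p.2) := by
        gcongr
    _ = _ := by ring

/-- coefficients of the x-derivative -/
def shX (c : ℕ × ℕ → ℂ) (p : ℕ × ℕ) : ℂ := (p.1 + 1) * c (p.1 + 1, p.2)

/-- coefficients of the y-derivative -/
def shY (c : ℕ × ℕ → ℂ) (p : ℕ × ℕ) : ℂ := (p.2 + 1) * c (p.1, p.2 + 1)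

theorem GoodCoeff.shX {c : ℕ × ℕ → ℂ} (hc : GoodCoeff c) : GoodCoeff (shX c) := by
  obtain ⟨C, K, hC, hb⟩ := hc
  refine ⟨C * 2 ^ K, K + 1, by positivity, fun m n => ?_⟩
  have h1 := hb (m + 1) n
  have h2 : ((m + 1 : ℕ) : ℝ) * ((m + 1 + n).choose (m + 1) : ℝ)
      = ((m + n + 1 : ℕ) : ℝ) * ((m + n).choose m : ℝ) := by
    have := Nat.add_one_mul_choose_eq (m + n) m
    rw [show m + 1 + n = m + n + 1 by ring]
    exact_mod_cast (by rw [this]; ring)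
  have h3 : ‖_root_.shX c (m, n)‖ = ((m + 1 : ℕ) : ℝ) * ‖c (m + 1, n)‖ := by
    rw [_root_.shX, norm_mul]
    congr 1
    have : ((m : ℂ) + 1) = ((m + 1 : ℕ) : ℂ) := by push_cast; rfl
    simp only [this, Complex.norm_natCast]
  have h4 : ((m + 1 + n + 1 : ℕ) : ℝ) ≤ 2 * ((m + n + 1 : ℕ) : ℝ) := by
    push_cast; linarith [Nat.cast_nonneg (α := ℝ) m, Nat.cast_nonneg (α := ℝ) n]
  calc ‖_root_.shX c (m, n)‖ = ((m + 1 : ℕ) : ℝ) * ‖c (m + 1, n)‖ := h3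
    _ ≤ ((m + 1 : ℕ) : ℝ) * (C * (2 * ((m + n + 1 : ℕ) : ℝ)) ^ K
          * ((m + 1 + n).choose (m + 1) : ℝ)) := by
        refine mul_le_mul_of_nonneg_left (h1.trans ?_) (by positivity)
        gcongr
    _ = C * (2 * ((m + n + 1 : ℕ) : ℝ)) ^ K *
          (((m + 1 : ℕ) : ℝ) * ((m + 1 + n).choose (m + 1) : ℝ)) := by ring
    _ = _ := by rw [h2, mul_pow]; ring

theorem GoodCoeff.swap {c : ℕ × ℕ → ℂ} (hc : GoodCoeff c) : GoodCoeff (fun p => c p.swap) := by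
  obtain ⟨C, K, hC, hb⟩ := hc
  refine ⟨C, K, hC, fun m n => ?_⟩
  have h := hb n m
  rw [show n + m = m + n by ring, ← Nat.choose_symm_add] at h
  exact h

theorem GoodCoeff.shY {c : ℕ × ℕ → ℂ} (hc : GoodCoeff c) : GoodCoeff (shY c) :=
  hc.swap.shX.swap

theorem reindexX {f : ℕ × ℕ → ℂ} (h0 : ∀ n, f (0, n) = 0) {S : ℂ} :
    HasSum (fun p : ℕ × ℕ => f (p.1 + 1, p.2)) S ↔ HasSum f S := by
  have hi : Function.Injective (fun p : ℕ × ℕ => (p.1 + 1, p.2)) := by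
    rintro ⟨a, b⟩ ⟨c, d⟩ h
    simpa using h
  refine hi.hasSum_iff (f := f) ?_
  rintro ⟨m, n⟩ hx
  cases m with
  | zero => exact h0 n
  | succ k => exact absurd ⟨(k, n), rfl⟩ hx

theorem reindexY {f : ℕ × ℕ → ℂ} (h0 : ∀ n, f (n, 0) = 0) {S : ℂ} :
    HasSum (fun p : ℕ × ℕ => f (p.1, p.2 + 1)) S ↔ HasSum f S := by
  have hi : Function.Injective (fun p : ℕ × ℕ => (p.1, p.2 + 1)) := by
    rintro ⟨a, b⟩ ⟨c, d⟩ h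
    simpa using h
  refine hi.hasSum_iff (f := f) ?_
  rintro ⟨m, n⟩ hx
  cases n with
  | zero => exact h0 m
  | succ k => exact absurd ⟨(m, k), rfl⟩ hx

/-- sum of the power series -/
noncomputable def GS (c : ℕ × ℕ → ℂ) (x y : ℂ) : ℂ := ∑' p : ℕ × ℕ, c p * (x ^ p.1 * y ^ p.2)

theorem GoodCoeff.hasSum {c : ℕ × ℕ → ℂ} (hc : GoodCoeff c) {x y : ℂ} (h : ‖x‖ + ‖y‖ < 1) :
    HasSum (fun p : ℕ × ℕ => c p * (x ^ p.1 * y ^ p.2)) (GS c x y) := by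
  refine Summable.hasSum (Summable.of_norm ?_)
  simpa only [norm_mul, norm_pow] using hc.summable (norm_nonneg x) (norm_nonneg y) h

theorem GoodCoeff.hasSumX {c : ℕ × ℕ → ℂ} (hc : GoodCoeff c) {x y : ℂ} (h : ‖x‖ + ‖y‖ < 1) :
    HasSum (fun p : ℕ × ℕ => c p * (p.1 * x ^ (p.1 - 1) * y ^ p.2)) (GS (_root_.shX c) x y) := by
  rw [← reindexX (by intro n; simp)]
  convert hc.shX.hasSum h using 2 with p
  simp [_root_.shX]; ring

theorem GoodCoeff.hasSumY {c : ℕ × ℕ → ℂ} (hc : GoodCoeff c) {x y : ℂ} (h : ‖x‖ + ‖y‖ < 1) :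
    HasSum (fun p : ℕ × ℕ => c p * (x ^ p.1 * (p.2 * y ^ (p.2 - 1)))) (GS (_root_.shY c) x y) := by
  rw [← reindexY (by intro n; simp)]
  convert hc.shY.hasSum h using 2 with p
  simp [_root_.shY]; ring

/-- derivative of the monomial term -/
noncomputable def termD (c : ℕ × ℕ → ℂ) (p : ℕ × ℕ) (z : ℂ × ℂ) : ℂ × ℂ →L[ℂ] ℂ :=
  (c p * (p.1 * z.1 ^ (p.1 - 1) * z.2 ^ p.2)) • ContinuousLinearMap.fst ℂ ℂ ℂ +
    (c p * (z.1 ^ p.1 * (p.2 * z.2 ^ (p.2 - 1)))) • ContinuousLinearMap.snd ℂ ℂ ℂ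

theorem hasFDerivAt_term (c : ℕ × ℕ → ℂ) (p : ℕ × ℕ) (z : ℂ × ℂ) :
    HasFDerivAt (fun z : ℂ × ℂ => c p * (z.1 ^ p.1 * z.2 ^ p.2)) (termD c p z) z := by
  have h1 := (hasFDerivAt_fst (𝕜 := ℂ) (p := z)).pow p.1
  have h2 := (hasFDerivAt_snd (𝕜 := ℂ) (p := z)).pow p.2
  refine ((h1.mul h2).const_mul (c p)).congr_fderiv ?_
  ext
  · simp only [termD, nsmul_eq_mul]; simp; left; ring
  · simp [termD]

theorem norm_termD_le (c : ℕ × ℕ → ℂ) (p : ℕ × ℕ) (z : ℂ × ℂ) {r s : ℝ}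
    (hr : ‖z.1‖ ≤ r) (hs : ‖z.2‖ ≤ s) :
    ‖termD c p z‖ ≤ ‖c p * (p.1 * (r : ℂ) ^ (p.1 - 1) * (s : ℂ) ^ p.2)‖ +
      ‖c p * ((r : ℂ) ^ p.1 * (p.2 * (s : ℂ) ^ (p.2 - 1)))‖ := by
  have hr0 : 0 ≤ r := (norm_nonneg _).trans hr
  have hs0 : 0 ≤ s := (norm_nonneg _).trans hs
  refine (norm_add_le _ _).trans (add_le_add ?_ ?_)
  · rw [norm_smul]
    refine (mul_le_of_le_one_right (norm_nonneg _) (ContinuousLinearMap.norm_fst_le ℂ ℂ ℂ)).trans ?_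
    simp only [norm_mul, norm_pow, Complex.norm_real, Real.norm_of_nonneg hr0,
      Real.norm_of_nonneg hs0]
    gcongr
  · rw [norm_smul]
    refine (mul_le_of_le_one_right (norm_nonneg _) (ContinuousLinearMap.norm_snd_le ℂ ℂ ℂ)).trans ?_
    simp only [norm_mul, norm_pow, Complex.norm_real, Real.norm_of_nonneg hr0,
      Real.norm_of_nonneg hs0]
    gcongr

theorem GoodCoeff.hasFDerivAt {c : ℕ × ℕ → ℂ} (hc : GoodCoeff c) {x y : ℂ} (h : ‖x‖ + ‖y‖ < 1) :
    HasFDerivAt (fun z : ℂ × ℂ => GS c z.1 z.2)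
      (GS (_root_.shX c) x y • ContinuousLinearMap.fst ℂ ℂ ℂ +
        GS (_root_.shY c) x y • ContinuousLinearMap.snd ℂ ℂ ℂ) (x, y) := by
  obtain ⟨e, he0, he⟩ : ∃ e : ℝ, 0 < e ∧ (‖x‖ + e) + (‖y‖ + e) < 1 :=
    ⟨(1 - ‖x‖ - ‖y‖) / 4, by linarith, by linarith⟩
  set r := ‖x‖ + e
  set s := ‖y‖ + e
  have hr0 : 0 ≤ r := by positivity
  have hs0 : 0 ≤ s := by positivity
  have hrs : ‖(r : ℂ)‖ + ‖(s : ℂ)‖ < 1 := by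
    rw [Complex.norm_real, Complex.norm_real, Real.norm_of_nonneg hr0, Real.norm_of_nonneg hs0]
    exact he
  have hu := (hc.hasSumX hrs).summable.norm.add (hc.hasSumY hrs).summable.norm
  have hmem : (x, y) ∈ Metric.ball (0 : ℂ) r ×ˢ Metric.ball (0 : ℂ) s := by
    simp [r, s, he0]
  have key := hasFDerivAt_tsum_of_isPreconnected (𝕜 := ℂ) hu
    (Metric.isOpen_ball.prod Metric.isOpen_ball)
    (((convex_ball (0 : ℂ) r).prod (convex_ball (0 : ℂ) s)).isPreconnected)
    (fun p z _ => hasFDerivAt_term c p z)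
    (fun p z hz => norm_termD_le c p z (mem_ball_zero_iff.1 hz.1).le (mem_ball_zero_iff.1 hz.2).le)
    hmem (hc.hasSum h).summable hmem
  have hs : HasSum (fun p => termD c p (x, y))
      (GS (_root_.shX c) x y • ContinuousLinearMap.fst ℂ ℂ ℂ +
        GS (_root_.shY c) x y • ContinuousLinearMap.snd ℂ ℂ ℂ) :=
    ((hc.hasSumX h).smul_const _).add ((hc.hasSumY h).smul_const _)
  rw [hs.tsum_eq] at key
  exact key

theorem GoodCoeff.derivX {c : ℕ × ℕ → ℂ} (hc : GoodCoeff c) {x y : ℂ} (h : ‖x‖ + ‖y‖ < 1) :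
    dX (GS c) x y = GS (_root_.shX c) x y := by
  have h1 : HasDerivAt (fun t : ℂ => (t, y)) ((1 : ℂ), (0 : ℂ)) x :=
    (hasDerivAt_id x).prodMk (hasDerivAt_const x y)
  have h2 := (hc.hasFDerivAt h).comp_hasDerivAt x h1
  have h3 := h2.deriv
  simp at h3
  exact h3

theorem GoodCoeff.derivY {c : ℕ × ℕ → ℂ} (hc : GoodCoeff c) {x y : ℂ} (h : ‖x‖ + ‖y‖ < 1) :
    dY (GS c) x y = GS (_root_.shY c) x y := by
  have h1 : HasDerivAt (fun t : ℂ => (x, t)) ((0 : ℂ), (1 : ℂ)) y :=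
    (hasDerivAt_const y x).prodMk (hasDerivAt_id y)
  have h2 := (hc.hasFDerivAt h).comp_hasDerivAt y h1
  have h3 := h2.deriv
  simp at h3
  exact h3

theorem dX_congr {F G : ℂ → ℂ → ℂ} (hFG : ∀ x y : ℂ, ‖x‖ + ‖y‖ < 1 → F x y = G x y)
    {x y : ℂ} (h : ‖x‖ + ‖y‖ < 1) : dX F x y = dX G x y := by
  refine Filter.EventuallyEq.deriv_eq ?_
  have : ∀ᶠ t in nhds x, ‖t‖ + ‖y‖ < 1 :=
    ((continuous_norm.add continuous_const).tendsto x).eventually_lt_const h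
  exact this.mono fun t ht => hFG t y ht

theorem dY_congr {F G : ℂ → ℂ → ℂ} (hFG : ∀ x y : ℂ, ‖x‖ + ‖y‖ < 1 → F x y = G x y)
    {x y : ℂ} (h : ‖x‖ + ‖y‖ < 1) : dY F x y = dY G x y := by
  refine Filter.EventuallyEq.deriv_eq ?_
  have : ∀ᶠ t in nhds y, ‖x‖ + ‖t‖ < 1 :=
    ((continuous_const.add continuous_norm).tendsto y).eventually_lt_const h
  exact this.mono fun t ht => hFG x t ht

theorem pochC_succ (a : ℂ) (n : ℕ) : pochC a (n + 1) = pochC a n * (a + n) := by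
  simp [pochC, Finset.prod_range_succ]

theorem pochC_one (n : ℕ) : pochC 1 n = (n.factorial : ℂ) := by
  induction n with
  | zero => simp [pochC]
  | succ k ih => rw [pochC_succ, ih, Nat.factorial_succ]; push_cast; ring

theorem pochC_ne_zero {a : ℂ} (h : ∀ n : ℕ, a ≠ -(n : ℂ)) (n : ℕ) : pochC a n ≠ 0 := by
  rw [pochC, Finset.prod_ne_zero_iff]
  intro i _ hi
  exact h i (eq_neg_of_add_eq_zero_left hi)

theorem lower_bound {a : ℂ} (h : ∀ n : ℕ, a ≠ -(n : ℂ)) :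
    ∃ B : ℝ, 0 ≤ B ∧ ∀ m : ℕ, (m : ℝ) + 1 ≤ B * ‖a + m‖ := by
  obtain ⟨M, hM⟩ := exists_nat_ge (2 * ‖a‖ + 1)
  have hnn : 0 ≤ ∑ i ∈ Finset.range M, ((i : ℝ) + 1) / ‖a + i‖ :=
    Finset.sum_nonneg fun i _ => by positivity
  refine ⟨2 + ∑ i ∈ Finset.range M, ((i : ℝ) + 1) / ‖a + i‖, by positivity, fun m => ?_⟩
  rcases lt_or_ge m M with hm | hm
  · have h1 := Finset.single_le_sum (f := fun i : ℕ => ((i : ℝ) + 1) / ‖a + i‖)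
      (fun i _ => by positivity) (Finset.mem_range.2 hm)
    have hpos : 0 < ‖a + m‖ := norm_pos_iff.2 fun hi => h m (eq_neg_of_add_eq_zero_left hi)
    rw [← div_le_iff₀ hpos]
    linarith
  · have hm' : (M : ℝ) ≤ m := by exact_mod_cast hm
    have h1 : (m : ℝ) - ‖a‖ ≤ ‖a + m‖ := by
      have := norm_sub_norm_le (m : ℂ) (-a)
      rw [norm_neg, Complex.norm_natCast, sub_neg_eq_add, add_comm (m : ℂ)] at this
      exact this
    nlinarith [norm_nonneg (a + m)]

theorem poch_ratio (b : ℂ) {a : ℂ} (h : ∀ n : ℕ, a ≠ -(n : ℂ)) :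
    ∃ A : ℕ, ∀ m : ℕ, ‖pochC b m‖ ≤ ((m + 1 : ℕ) : ℝ) ^ A * ‖pochC a m‖ := by
  obtain ⟨B, hB0, hB⟩ := lower_bound h
  obtain ⟨A, hA⟩ := exists_nat_ge (‖b - a‖ * B)
  refine ⟨A, fun m => ?_⟩
  induction m with
  | zero => simp [pochC]
  | succ m ih =>
    rw [pochC_succ, pochC_succ, norm_mul, norm_mul]
    have hm : (0 : ℝ) < (m : ℝ) + 1 := by positivity
    have h1 : ‖b + m‖ ≤ ‖a + m‖ + ‖b - a‖ := by
      have := norm_add_le (a + m) (b - a)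
      rwa [show a + m + (b - a) = b + m by ring] at this
    have h2 : ‖b - a‖ * ((m : ℝ) + 1) ≤ A * ‖a + m‖ := by
      calc ‖b - a‖ * ((m : ℝ) + 1) ≤ ‖b - a‖ * (B * ‖a + m‖) := by gcongr; exact hB m
        _ = ‖b - a‖ * B * ‖a + m‖ := by ring
        _ ≤ A * ‖a + m‖ := by gcongr
    have h3 : ‖b + m‖ ≤ (1 + A * (1 / ((m : ℝ) + 1))) * ‖a + m‖ := by
      have : ‖b - a‖ ≤ A * ‖a + m‖ / ((m : ℝ) + 1) := by rwa [le_div_iff₀ hm]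
      calc ‖b + m‖ ≤ ‖a + m‖ + A * ‖a + m‖ / ((m : ℝ) + 1) := by linarith
        _ = _ := by ring
    have h4 : 1 + A * (1 / ((m : ℝ) + 1)) ≤ (1 + 1 / ((m : ℝ) + 1)) ^ A :=
      one_add_mul_le_pow (by have : 0 ≤ 1 / ((m : ℝ) + 1) := by positivity
                             linarith) A
    calc ‖pochC b m‖ * ‖b + m‖
        ≤ (((m + 1 : ℕ) : ℝ) ^ A * ‖pochC a m‖) * ((1 + 1 / ((m : ℝ) + 1)) ^ A * ‖a + m‖) := by
          refine mul_le_mul ih (h3.trans ?_) (norm_nonneg _) (by positivity)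
          gcongr
      _ = (((m + 1 : ℕ) : ℝ) * (1 + 1 / ((m : ℝ) + 1))) ^ A * (‖pochC a m‖ * ‖a + m‖) := by
          rw [mul_pow]; ring
      _ = _ := by
          congr 2
          push_cast
          field_simp

/-- Appell coefficients -/
noncomputable def appC (α β₁ β₂ γ₁ γ₂ : ℂ) (p : ℕ × ℕ) : ℂ :=
  pochC α (p.1 + p.2) * pochC β₁ p.1 * pochC β₂ p.2 /
      (pochC γ₁ p.1 * pochC γ₂ p.2 * p.1.factorial * p.2.factorial)

theorem appC_good (α β₁ β₂ γ₁ γ₂ : ℂ) (hγ₁ : ∀ n : ℕ, γ₁ ≠ -(n : ℂ))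
    (hγ₂ : ∀ n : ℕ, γ₂ ≠ -(n : ℂ)) : GoodCoeff (appC α β₁ β₂ γ₁ γ₂) := by
  have hone : ∀ n : ℕ, (1 : ℂ) ≠ -(n : ℂ) := by
    intro n hn
    have h2 : ((n + 1 : ℕ) : ℂ) = 0 := by push_cast; linear_combination hn
    exact absurd (Nat.cast_eq_zero.1 h2) (by omega)
  obtain ⟨A, hA⟩ := poch_ratio α hone
  obtain ⟨A1, hA1⟩ := poch_ratio β₁ hγ₁
  obtain ⟨A2, hA2⟩ := poch_ratio β₂ hγ₂
  refine ⟨1, A + A1 + A2, zero_le_one, fun m n => ?_⟩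
  have g1 : 0 < ‖pochC γ₁ m‖ := norm_pos_iff.2 (pochC_ne_zero hγ₁ m)
  have g2 : 0 < ‖pochC γ₂ n‖ := norm_pos_iff.2 (pochC_ne_zero hγ₂ n)
  have f1 : (0 : ℝ) < m.factorial := by exact_mod_cast m.factorial_pos
  have f2 : (0 : ℝ) < n.factorial := by exact_mod_cast n.factorial_pos
  have k0 := hA (m + n)
  rw [pochC_one, Complex.norm_natCast] at k0
  have hch : ((m + n).factorial : ℝ) = ((m + n).choose m : ℝ) * m.factorial * n.factorial := by
    have := Nat.add_choose_mul_factorial_mul_factorial m n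
    rw [← Nat.choose_symm_add] at this
    exact_mod_cast this.symm
  have k1 : ‖pochC β₁ m‖ ≤ ((m + n + 1 : ℕ) : ℝ) ^ A1 * ‖pochC γ₁ m‖ := by
    refine (hA1 m).trans ?_
    gcongr
    omega
  have k2 : ‖pochC β₂ n‖ ≤ ((m + n + 1 : ℕ) : ℝ) ^ A2 * ‖pochC γ₂ n‖ := by
    refine (hA2 n).trans ?_
    gcongr
    omega
  simp only [appC, norm_div, norm_mul, Complex.norm_natCast]
  rw [div_le_iff₀ (by positivity)]
  calc ‖pochC α (m + n)‖ * ‖pochC β₁ m‖ * ‖pochC β₂ n‖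
      ≤ (((m + n + 1 : ℕ) : ℝ) ^ A * ((m + n).factorial : ℝ)) *
        (((m + n + 1 : ℕ) : ℝ) ^ A1 * ‖pochC γ₁ m‖) *
        (((m + n + 1 : ℕ) : ℝ) ^ A2 * ‖pochC γ₂ n‖) := by gcongr
    _ = _ := by rw [hch, pow_add, pow_add]; ring

theorem appC_rec (α β₁ β₂ γ₁ γ₂ : ℂ) (hγ₁ : ∀ n : ℕ, γ₁ ≠ -(n : ℂ))
    (hγ₂ : ∀ n : ℕ, γ₂ ≠ -(n : ℂ)) (m n : ℕ) :
    ((m : ℂ) + 1) * (γ₁ + m) * appC α β₁ β₂ γ₁ γ₂ (m + 1, n) =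
      (α + m + n) * (β₁ + m) * appC α β₁ β₂ γ₁ γ₂ (m, n) := by
  have g1 := pochC_ne_zero hγ₁ m
  have g2 := pochC_ne_zero hγ₂ n
  have g3 : γ₁ + m ≠ 0 := fun hi => hγ₁ m (eq_neg_of_add_eq_zero_left hi)
  have f1 : (m.factorial : ℂ) ≠ 0 := by exact_mod_cast m.factorial_ne_zero
  have f2 : (n.factorial : ℂ) ≠ 0 := by exact_mod_cast n.factorial_ne_zero
  have f3 : (m : ℂ) + 1 ≠ 0 := by exact_mod_cast m.succ_ne_zero
  simp only [appC]
  rw [show m + 1 + n = m + n + 1 by ring, pochC_succ, pochC_succ, pochC_succ, Nat.factorial_succ]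
  push_cast
  field_simp
  ring

theorem appellF2C_eq (α β₁ β₂ γ₁ γ₂ : ℂ) :
    appellF2C α β₁ β₂ γ₁ γ₂ = GS (appC α β₁ β₂ γ₁ γ₂) := by
  funext x y
  simp only [appellF2C, GS, appellTermC, appC, mul_assoc]

/-- For `γ₁, γ₂` not non-positive integers, the Appell `F₂` double series converges
absolutely on `D = {(x,y) : |x| + |y| < 1}`, defines a holomorphic function of `(x,y)`
there, and satisfies the first Appell `F₂` partial differential equation
`x(1−x) F_{xx} − x y F_{xy} + (γ₁ − (α+β₁+1)x) F_x − β₁ y F_y − α β₁ F = 0` on `D`. -/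
theorem appellF2_series_holomorphic_and_first_PDE
    (α β₁ β₂ γ₁ γ₂ : ℂ) (hγ₁ : ∀ n : ℕ, γ₁ ≠ -(n : ℂ)) (hγ₂ : ∀ n : ℕ, γ₂ ≠ -(n : ℂ)) :
    (∀ x y : ℂ, ‖x‖ + ‖y‖ < 1 →
      Summable fun p : ℕ × ℕ => ‖appellTermC α β₁ β₂ γ₁ γ₂ x y p‖) ∧
    DifferentiableOn ℂ (fun p : ℂ × ℂ => appellF2C α β₁ β₂ γ₁ γ₂ p.1 p.2)
      {p : ℂ × ℂ | ‖p.1‖ + ‖p.2‖ < 1} ∧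
    (∀ x y : ℂ, ‖x‖ + ‖y‖ < 1 →
      x * (1 - x) * dX (dX (appellF2C α β₁ β₂ γ₁ γ₂)) x y
        - x * y * dY (dX (appellF2C α β₁ β₂ γ₁ γ₂)) x y
        + (γ₁ - (α + β₁ + 1) * x) * dX (appellF2C α β₁ β₂ γ₁ γ₂) x y
        - β₁ * y * dY (appellF2C α β₁ β₂ γ₁ γ₂) x y
        - α * β₁ * appellF2C α β₁ β₂ γ₁ γ₂ x y = 0) := by
  have hc := appC_good α β₁ β₂ γ₁ γ₂ hγ₁ hγ₂
  have hrec := appC_rec α β₁ β₂ γ₁ γ₂ hγ₁ hγ₂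
  rw [appellF2C_eq]
  refine ⟨fun x y h => ?_, ?_, fun x y h => ?_⟩
  · have := (hc.hasSum h).summable.norm
    refine this.congr fun p => ?_
    simp only [appellTermC, appC, mul_assoc]
  · rintro ⟨x, y⟩ h
    exact (hc.hasFDerivAt h).differentiableAt.differentiableWithinAt
  · have hx := fun x y (h : ‖x‖ + ‖y‖ < 1) => hc.derivX h
    rw [dX_congr hx h, dY_congr hx h, hx x y h, hc.derivY h, hc.shX.derivX h, hc.shX.derivY h]
    clear hx
    set c := appC α β₁ β₂ γ₁ γ₂
    -- the Euler-operator forms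
    have s0 := hc.hasSum h
    have sx := (hc.hasSumX h).mul_left x
    have sy := (hc.hasSumY h).mul_left y
    have s1 := hc.shX.hasSum h
    have sxx1 := (hc.shX.hasSumX h).mul_left x
    have sxx2 : HasSum (fun p : ℕ × ℕ => (p.1 : ℂ) * (p.1 - 1) * c p * (x ^ p.1 * y ^ p.2))
        (x * (x * GS (shX (shX c)) x y)) := by
      rw [← reindexX (by intro n; simp)]
      refine (sxx1.mul_left x).congr_fun fun p => ?_
      rcases p with ⟨_ | m, n⟩
      · simp
      · simp [shX]; ring
    have sxy : HasSum (fun p : ℕ × ℕ => (p.1 : ℂ) * p.2 * c p * (x ^ p.1 * y ^ p.2))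
        (x * (y * GS (shY (shX c)) x y)) := by
      rw [← reindexX (by intro n; simp)]
      refine (((hc.shX.hasSumY h).mul_left y).mul_left x).congr_fun fun p => ?_
      rcases p with ⟨m, _ | n⟩
      · simp
      · simp [shX]; ring
    have tot := ((((sxx1.sub sxx2).sub sxy).add
      ((s1.mul_left γ₁).sub (sx.mul_left (α + β₁ + 1)))).sub (sy.mul_left β₁)).sub
        (s0.mul_left (α * β₁))
    have hz : HasSum (fun _ : ℕ × ℕ => (0 : ℂ)) 0 := hasSum_zero
    have e := tot.unique (hz.congr_fun ?_)
    · linear_combination e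
    · rintro ⟨m, n⟩
      have hr := hrec m n
      have e1 : x * ((m : ℂ) * x ^ (m - 1)) = m * x ^ m := by
        cases m with
        | zero => simp
        | succ k => simp [pow_succ]; ring
      have e2 : y * ((n : ℂ) * y ^ (n - 1)) = n * y ^ n := by
        cases n with
        | zero => simp
        | succ k => simp [pow_succ]; ring
      simp only [shX]
      linear_combination (x ^ m * y ^ n) * hr + ((m + 1) * c (m + 1, n) * y ^ n
        - (α + β₁ + 1) * c (m, n) * y ^ n) * e1 - β₁ * c (m, n) * x ^ m * e2
end

section
/- For Λ₁, Λ₂ ∈ (0,1) define the four period functions Π₀(Λ₁,Λ₂) = (4/π²)(Λ₁+Λ₂) K(Λ₁²) K(1−Λ₂²), Π₁(Λ₁,Λ₂) = (4i/π²)(Λ₁+Λ₂) K(1−Λ₁²) K(1−Λ₂²), Π₂(Λ₁,Λ₂) = (4i/π²)(Λ₁+Λ₂) K(Λ₁²) K(Λ₂²), Π₃(Λ₁,Λ₂) = −(4/π²)(Λ₁+Λ₂) K(1−Λ₁²) K(Λ₂²). Let (Λ₁⁰,Λ₂⁰) ∈ (0,1)² with Λ₁⁰ ≠ Λ₂⁰,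 and let T(Λ₁,Λ₂) = (4Λ₁Λ₂/(Λ₁+Λ₂)², −(1−Λ₁²)(1−Λ₂²)/(Λ₁+Λ₂)²). Then for each j ∈ {0,1,2,3} there exist an open set U ⊆ ℂ² containing T(Λ₁⁰,Λ₂⁰), a holomorphic function F : U → ℂ satisfying on U both Appell F₂ partial differential equations with parameters α = 1/2, β₁ = β₂ = 1/2, γ₁ = γ₂ = 1 (namely x(1−x)F_{xx} − xyF_{xy} + (1 − 2x)F_x − (1/2)yF_y − (1/4)F = 0 and y(1−y)F_{yy} − xyF_{xy} + (1 − 2y)F_y − (1/2)xF_x − (1/4)F = 0), and an open neighborhood V of (Λ₁⁰,Λ₂⁰) in ℝ² with T(V) ⊆ U, such that F(T(Λ₁,Λ₂)) = Π_j(Λ₁,Λ₂) for all (Λ₁,Λ₂) ∈ V. -/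
/-- The Gauss hypergeometric function `₂F₁(a,b;c;z)`, defined by its series. -/
noncomputable def hyp2F1C (a b c z : ℂ) : ℂ :=
  ∑' n : ℕ, pochC a n * pochC b n / (pochC c n * n.factorial) * z ^ n

/-- The complete elliptic integral of the first kind `K(z) = (π/2)·₂F₁(1/2,1/2;1;z)`. -/
noncomputable def ellipticKC (z : ℂ) : ℂ :=
  (Real.pi : ℂ) / 2 * hyp2F1C (1 / 2) (1 / 2) 1 z

/-- The four period functions `Π₀, Π₁, Π₂, Π₃` of the traintrack K3 family. -/
noncomputable def trainPeriod (j : Fin 4) (Λ₁ Λ₂ : ℝ) : ℂ :=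
  match j with
  | 0 => 4 / (Real.pi : ℂ) ^ 2 * ((Λ₁ : ℂ) + (Λ₂ : ℂ)) *
      ellipticKC ((Λ₁ : ℂ) ^ 2) * ellipticKC (1 - (Λ₂ : ℂ) ^ 2)
  | 1 => 4 * Complex.I / (Real.pi : ℂ) ^ 2 * ((Λ₁ : ℂ) + (Λ₂ : ℂ)) *
      ellipticKC (1 - (Λ₁ : ℂ) ^ 2) * ellipticKC (1 - (Λ₂ : ℂ) ^ 2)
  | 2 => 4 * Complex.I / (Real.pi : ℂ) ^ 2 * ((Λ₁ : ℂ) + (Λ₂ : ℂ)) *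
      ellipticKC ((Λ₁ : ℂ) ^ 2) * ellipticKC ((Λ₂ : ℂ) ^ 2)
  | 3 => -(4 / (Real.pi : ℂ) ^ 2) * ((Λ₁ : ℂ) + (Λ₂ : ℂ)) *
      ellipticKC (1 - (Λ₁ : ℂ) ^ 2) * ellipticKC ((Λ₂ : ℂ) ^ 2)

/-- The Clingher–Doran–Malmendier change of variables
`T(Λ₁,Λ₂) = (4Λ₁Λ₂/(Λ₁+Λ₂)², −(1−Λ₁²)(1−Λ₂²)/(Λ₁+Λ₂)²)`. -/
noncomputable def Tcdm (Λ₁ Λ₂ : ℝ) : ℂ × ℂ :=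
  (((4 * Λ₁ * Λ₂ / (Λ₁ + Λ₂) ^ 2 : ℝ) : ℂ),
    ((-((1 - Λ₁ ^ 2) * (1 - Λ₂ ^ 2) / (Λ₁ + Λ₂) ^ 2) : ℝ) : ℂ))

/-- Termwise differentiation of a power series with polynomially bounded coefficients. -/
lemma ps_summable (c : ℕ → ℂ) (k : ℕ) (hc : ∀ n, ‖c n‖ ≤ ((n : ℝ) + 1) ^ k) (z : ℂ) (hz : ‖z‖ < 1) :
    Summable (fun n => c n * z ^ n) := by
  have h1 : Summable (fun n : ℕ => ((n : ℝ) + 1) ^ k * ‖z‖ ^ n) := by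
    have h := summable_pow_mul_geometric_of_norm_lt_one (R := ℝ) k (r := max ‖z‖ (1/2))
      (by rw [Real.norm_of_nonneg (by positivity)]; exact max_lt hz (by norm_num))
    have h' := ((summable_nat_add_iff 1).2 h).mul_left 2
    refine Summable.of_nonneg_of_le (fun n => by positivity) (fun n => ?_) h'
    push_cast
    have e1 : ‖z‖ ^ n ≤ (max ‖z‖ (1/2)) ^ n := by gcongr; exact le_max_left _ _
    have e2 : (1/2 : ℝ) ≤ max ‖z‖ (1/2) := le_max_right _ _
    have e3 : (0:ℝ) ≤ ((n : ℝ) + 1) ^ k := by positivity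
    have e4 : (0:ℝ) ≤ (max ‖z‖ (1/2)) ^ n := by positivity
    rw [pow_succ]
    have e5 : (max ‖z‖ (1/2)) ^ n ≤ 2 * ((max ‖z‖ (1/2)) ^ n * (max ‖z‖ (1/2))) := by
      nlinarith
    calc _ ≤ ((n : ℝ) + 1) ^ k * (max ‖z‖ (1/2)) ^ n := by gcongr
      _ ≤ ((n : ℝ) + 1) ^ k * (2 * ((max ‖z‖ (1/2)) ^ n * (max ‖z‖ (1/2)))) := by gcongr
      _ = _ := by ring
  refine Summable.of_norm_bounded h1 (fun n => ?_)
  rw [norm_mul, norm_pow]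
  gcongr
  exact hc n

lemma ps_bound_succ (c : ℕ → ℂ) (k : ℕ) (hc : ∀ n, ‖c n‖ ≤ ((n : ℝ) + 1) ^ k) :
    ∀ n : ℕ, ‖((n : ℂ)) * c n‖ ≤ ((n : ℝ) + 1) ^ (k+1) := by
  intro n
  rw [norm_mul, Complex.norm_natCast, pow_succ, mul_comm]
  have := hc n
  gcongr
  linarith

lemma ps_hasDerivAt (c : ℕ → ℂ) (k : ℕ) (hc : ∀ n, ‖c n‖ ≤ ((n : ℝ) + 1) ^ k) (z : ℂ) (hz : ‖z‖ < 1) :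
    HasDerivAt (fun z => ∑' n, c n * z ^ n) (∑' n : ℕ, ((n : ℂ) + 1) * c (n + 1) * z ^ n) z := by
  obtain ⟨r, hr, hr1⟩ := exists_between hz
  have hr0 : 0 < r := lt_of_le_of_lt (norm_nonneg _) hr
  have hs := ps_summable (fun n => ((((n : ℝ) + 1) ^ (k+1) : ℝ) : ℂ)) (k+1)
    (by intro n; rw [Complex.norm_real, Real.norm_of_nonneg (by positivity)]) (r : ℂ)
    (by rw [Complex.norm_real, Real.norm_of_nonneg hr0.le]; exact hr1)
  have hs' : Summable (fun n : ℕ => ((n : ℝ) + 1) ^ (k+1) * r ^ n * r⁻¹) :=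
    Summable.mul_right _ (by exact_mod_cast hs)
  have key := hasDerivAt_tsum_of_isPreconnected (g := fun n z => c n * z ^ n)
    (g' := fun n z => c n * ((n : ℂ) * z ^ (n - 1))) (t := Metric.ball 0 r) (y₀ := 0) (y := z) hs'
    Metric.isOpen_ball (convex_ball _ _).isPreconnected
    (fun n y _ => (hasDerivAt_pow n y).const_mul _) ?_ (by simpa using hr0) ?_ (by simpa using hr)
  · refine key.congr_deriv ?_
    have hsum : Summable (fun n : ℕ => c n * ((n : ℂ) * z ^ (n - 1))) := by
      rw [← summable_nat_add_iff 1]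
      have h2 := (summable_nat_add_iff 1).2 (ps_summable (fun n : ℕ => (n : ℂ) * c n) (k+1) (ps_bound_succ c k hc) z hz)
      by_cases h0 : z = 0
      · subst h0
        refine summable_of_ne_finset_zero (s := {0}) (fun b hb => ?_)
        have : b ≠ 0 := by simpa using hb
        simp [this]
      · refine (h2.mul_right z⁻¹).congr (fun n => ?_)
        simp only [Nat.add_sub_cancel, pow_succ]
        field_simp
    rw [hsum.tsum_eq_zero_add]
    simp only [Nat.cast_zero, zero_mul, mul_zero, zero_add, Nat.add_sub_cancel]
    refine tsum_congr (fun n => ?_)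
    push_cast; ring
  · intro n y hy
    have hy' : ‖y‖ < r := by simpa using hy
    have := ps_bound_succ c k hc n
    rcases n with _ | n
    · simp; positivity
    · rw [Nat.add_sub_cancel, ← mul_assoc, norm_mul, mul_comm (c _), norm_pow]
      have : ‖y‖ ^ n ≤ r ^ (n+1) * r⁻¹ := by
        rw [pow_succ, mul_assoc, mul_inv_cancel₀ hr0.ne', mul_one]; gcongr
      rw [mul_assoc]
      gcongr
  · refine summable_of_ne_finset_zero (s := {0}) (fun b hb => ?_)
    have : b ≠ 0 := by simpa using hb
    simp [this]

lemma ps_shift (c d : ℕ → ℂ) (z : ℂ) (h0 : d 0 = 0) (h1 : ∀ n, d (n+1) = c n)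
    (hs : Summable (fun n => c n * z ^ n)) :
    HasSum (fun n => d n * z ^ n) (z * ∑' n, c n * z ^ n) := by
  rw [← hasSum_nat_add_iff' 1]
  simp only [Finset.sum_range_one, h0, zero_mul, sub_zero, h1]
  refine (hs.hasSum.mul_left z).congr_fun ?_ |> fun h => h
  intro n
  ring

noncomputable def kcoef (n : ℕ) : ℂ :=
  pochC (1/2) n * pochC (1/2) n / (pochC 1 n * n.factorial)

lemma kcoef_succ (n : ℕ) : ((n : ℂ) + 1) ^ 2 * kcoef (n+1) = ((n : ℂ) + 1/2) ^ 2 * kcoef n := by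
  have hn : ((n : ℂ) + 1) ≠ 0 := by exact_mod_cast Nat.succ_ne_zero n
  have hp : pochC 1 n ≠ 0 := by
    unfold pochC
    refine Finset.prod_ne_zero_iff.2 (fun i _ => ?_)
    rw [add_comm]; exact_mod_cast Nat.succ_ne_zero i
  have hf : (n.factorial : ℂ) ≠ 0 := by exact_mod_cast n.factorial_ne_zero
  have e1 : ∀ a, pochC a (n+1) = pochC a n * (a + n) := fun a => by
    unfold pochC; rw [Finset.prod_range_succ]
  unfold kcoef
  rw [e1, e1, Nat.factorial_succ]
  push_cast
  have hn' : (1 + (n : ℂ)) ≠ 0 := by rwa [add_comm]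
  field_simp
  ring

lemma kcoef_bound (n : ℕ) : ‖kcoef n‖ ≤ 1 := by
  induction n with
  | zero => simp [kcoef, pochC]
  | succ n ih =>
    have h := congrArg norm (kcoef_succ n)
    rw [norm_mul, norm_mul, norm_pow, norm_pow] at h
    have e1 : ‖(n : ℂ) + 1‖ = n + 1 := by
      have : ((n : ℂ) + 1) = ((n + 1 : ℝ) : ℂ) := by push_cast; rfl
      rw [this, Complex.norm_real, Real.norm_of_nonneg (by positivity)]
    have e2 : ‖(n : ℂ) + 1/2‖ = n + 1/2 := by
      have : ((n : ℂ) + 1/2) = ((n + 1/2 : ℝ) : ℂ) := by push_cast; rfl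
      rw [this, Complex.norm_real, Real.norm_of_nonneg (by positivity)]
    rw [e1, e2] at h
    have hn : (0:ℝ) ≤ n := by positivity
    by_contra! hc
    nlinarith [mul_nonneg hn hn, norm_nonneg (kcoef n), sq_nonneg ((n:ℝ)+1/2)]

noncomputable def h0 (z : ℂ) : ℂ := hyp2F1C (1/2) (1/2) 1 z
noncomputable def h1 (z : ℂ) : ℂ := ∑' n : ℕ, ((n : ℂ) + 1) * kcoef (n + 1) * z ^ n
noncomputable def h2 (z : ℂ) : ℂ :=
  ∑' n : ℕ, ((n : ℂ) + 1) * ((((n + 1 : ℕ) : ℂ) + 1) * kcoef (n + 1 + 1)) * z ^ n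

lemma kc1_bound (n : ℕ) : ‖((n : ℂ) + 1) * kcoef (n + 1)‖ ≤ ((n : ℝ) + 1) ^ 1 := by
  have e1 : ‖(n : ℂ) + 1‖ = n + 1 := by
    have : ((n : ℂ) + 1) = ((n + 1 : ℝ) : ℂ) := by push_cast; rfl
    rw [this, Complex.norm_real, Real.norm_of_nonneg (by positivity)]
  rw [norm_mul, e1, pow_one]
  nlinarith [kcoef_bound (n+1), norm_nonneg (kcoef (n+1)), (Nat.cast_nonneg n : (0:ℝ) ≤ n)]

lemma h0_deriv (z : ℂ) (hz : ‖z‖ < 1) : HasDerivAt h0 (h1 z) z :=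
  ps_hasDerivAt kcoef 0 (by simpa using kcoef_bound) z hz

lemma h1_deriv (z : ℂ) (hz : ‖z‖ < 1) : HasDerivAt h1 (h2 z) z :=
  ps_hasDerivAt _ 1 kc1_bound z hz

lemma kc2_bound (n : ℕ) : ‖((n : ℂ) + 1) * ((((n + 1 : ℕ) : ℂ) + 1) * kcoef (n + 1 + 1))‖
    ≤ ((n : ℝ) + 1) ^ 3 := by
  have e1 : ‖(n : ℂ) + 1‖ = n + 1 := by
    have : ((n : ℂ) + 1) = ((n + 1 : ℝ) : ℂ) := by push_cast; rfl
    rw [this, Complex.norm_real, Real.norm_of_nonneg (by positivity)]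
  have h := kc1_bound (n+1)
  rw [norm_mul, e1]
  push_cast at h ⊢
  have hn : (0:ℝ) ≤ n := by positivity
  rw [pow_one] at h
  have h' : ((n:ℝ)+1) * ‖((n : ℂ) + 1 + 1) * kcoef (n + 1 + 1)‖ ≤ ((n:ℝ)+1) * (n + 1 + 1) := by gcongr
  by_cases h0 : n = 0
  · subst h0
    have e := kcoef_succ 0
    have e' := kcoef_succ 1
    have k0 : kcoef 0 = 1 := by simp [kcoef, pochC]
    rw [k0] at e
    norm_num at e
    rw [e] at e'
    have : kcoef 2 = 9/64 := by norm_num at e'; linear_combination e'/4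
    norm_num [this]
  · have : (1:ℝ) ≤ n := by exact_mod_cast Nat.one_le_iff_ne_zero.2 h0
    nlinarith [mul_nonneg hn hn]

lemma h_ode (z : ℂ) (hz : ‖z‖ < 1) :
    z * (1 - z) * h2 z + (1 - 2 * z) * h1 z - 1/4 * h0 z = 0 := by
  have s0 : HasSum (fun n => kcoef n * z ^ n) (h0 z) :=
    (ps_summable kcoef 0 (by simpa using kcoef_bound) z hz).hasSum
  have S1 := ps_summable _ 1 kc1_bound z hz
  have S2 := ps_summable _ 3 kc2_bound z hz
  have s1 : HasSum _ (h1 z) := S1.hasSum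
  have zs1 := ps_shift _ (fun n => (n : ℂ) * kcoef n) z (by simp) (by intro n; push_cast; ring) S1
  have zs2 := ps_shift _ (fun n => (n : ℂ) * (((n : ℂ) + 1) * kcoef (n+1))) z (by simp)
    (by intro n; push_cast; ring) S2
  have zzs2 := ps_shift _ (fun n => (n : ℂ) * (((n : ℂ) - 1) * kcoef n)) z (by simp)
    (by intro n; push_cast; ring) zs2.summable
  rw [zs2.tsum_eq] at zzs2
  have tot := (((zs2.sub zzs2).add s1).sub (zs1.mul_left 2)).sub (s0.mul_left (1/4))
  have hz0 : HasSum (fun _ : ℕ => (0:ℂ)) 0 := hasSum_zero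
  have := tot.unique (hz0.congr_fun (fun n => ?_) |> fun h => h)
  · change z * h2 z - z * (z * h2 z) + h1 z - 2 * (z * h1 z) - 1/4 * h0 z = 0 at this
    linear_combination this
  · linear_combination z ^ n * kcoef_succ n


/-- solution of the ODE in the modulus at the point `k` -/
def SolAt (f f1 : ℂ → ℂ) (k : ℂ) : Prop :=
  HasDerivAt f (f1 k) k ∧ HasDerivAt f1 ((k * f k - (1 - 3 * k ^ 2) * f1 k) / (k * (1 - k ^ 2))) k

lemma curve0 (A B f f1 g g1 : ℂ → ℂ) (dA dB t : ℂ) (hA : HasDerivAt A dA t) (hB : HasDerivAt B dB t)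
    (hf : SolAt f f1 (A t)) (hg : SolAt g g1 (B t)) :
    HasDerivAt (fun t => (A t + B t) * f (A t) * g (B t))
      ((dA + dB) * f (A t) * g (B t) + (A t + B t) * (f1 (A t) * dA) * g (B t)
        + (A t + B t) * f (A t) * (g1 (B t) * dB)) t := by
  have h1 := hf.1.comp t hA
  have h2 := hg.1.comp t hB
  refine (((hA.add hB).mul h1).mul h2).congr_deriv ?_
  simp only [Function.comp, Pi.add_apply, Pi.mul_apply]
  ring

noncomputable def Gx (a b f f1 g g1 : ℂ) : ℂ :=
  (a + b) ^ 3 / (4 * (b - a) * (1 - a * b)) * ((b - a) * f * g + (1 - a ^ 2) * f1 * g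
    - (1 - b ^ 2) * f * g1)
noncomputable def Gy (a b f f1 g g1 : ℂ) : ℂ :=
  (a + b) ^ 3 / (2 * (1 - a * b) * (1 + a * b)) * (f * g + a * f1 * g + b * f * g1)

noncomputable def dGx (a b f f1 f2 g g1 g2 dA dB : ℂ) : ℂ :=
  (3 * (a + b) ^ 2 * (dA + dB) * (4 * (b - a) * (1 - a * b)) - (a + b) ^ 3 *
    (4 * (dB - dA) * (1 - a * b) - 4 * (b - a) * (dA * b + a * dB))) /
    (4 * (b - a) * (1 - a * b)) ^ 2 * ((b - a) * f * g + (1 - a ^ 2) * f1 * g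
    - (1 - b ^ 2) * f * g1) + (a + b) ^ 3 / (4 * (b - a) * (1 - a * b)) *
    ((dB - dA) * f * g + (b - a) * (f1 * dA) * g + (b - a) * f * (g1 * dB)
     - 2 * a * dA * f1 * g + (1 - a ^ 2) * (f2 * dA) * g + (1 - a ^ 2) * f1 * (g1 * dB)
     + 2 * b * dB * f * g1 - (1 - b ^ 2) * (f1 * dA) * g1 - (1 - b ^ 2) * f * (g2 * dB))

noncomputable def dGy (a b f f1 f2 g g1 g2 dA dB : ℂ) : ℂ :=
  (3 * (a + b) ^ 2 * (dA + dB) * (2 * (1 - a * b) * (1 + a * b)) - (a + b) ^ 3 *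
    (-4 * (a * b) * (dA * b + a * dB))) /
    (2 * (1 - a * b) * (1 + a * b)) ^ 2 * (f * g + a * f1 * g + b * f * g1)
   + (a + b) ^ 3 / (2 * (1 - a * b) * (1 + a * b)) *
    (f1 * dA * g + f * (g1 * dB) + dA * f1 * g + a * (f2 * dA) * g + a * f1 * (g1 * dB)
     + dB * f * g1 + b * (f1 * dA) * g1 + b * f * (g2 * dB))

lemma curveX (A B f f1 g g1 : ℂ → ℂ) (dA dB t : ℂ) (hA : HasDerivAt A dA t) (hB : HasDerivAt B dB t)
    (hf : SolAt f f1 (A t)) (hg : SolAt g g1 (B t)) (h1 : B t - A t ≠ 0) (h2 : 1 - A t * B t ≠ 0) :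
    HasDerivAt (fun t => Gx (A t) (B t) (f (A t)) (f1 (A t)) (g (B t)) (g1 (B t)))
      (dGx (A t) (B t) (f (A t)) (f1 (A t))
        ((A t * f (A t) - (1 - 3 * A t ^ 2) * f1 (A t)) / (A t * (1 - A t ^ 2)))
        (g (B t)) (g1 (B t))
        ((B t * g (B t) - (1 - 3 * B t ^ 2) * g1 (B t)) / (B t * (1 - B t ^ 2))) dA dB) t := by
  have e1 := hf.1.comp t hA
  have e2 := hg.1.comp t hB
  have e3 := hf.2.comp t hA
  have e4 := hg.2.comp t hB
  have hden : (4 * (B t - A t) * (1 - A t * B t)) ≠ 0 := by simp [h1, h2]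
  have n1 := ((hA.add hB).pow 3).div
    (((hB.sub hA).const_mul 4).mul ((hA.mul hB).const_sub 1)) hden
  have n2 := ((((hB.sub hA).mul e1).mul e2).add ((((hA.pow 2).const_sub 1).mul e3).mul e2)).sub
    ((((hB.pow 2).const_sub 1).mul e1).mul e4)
  refine (n1.mul n2).congr_deriv ?_
  simp only [Function.comp, Pi.add_apply, Pi.mul_apply, Pi.sub_apply, Pi.div_apply, Pi.pow_apply, dGx]
  generalize ((A t * f (A t) - (1 - 3 * A t ^ 2) * f1 (A t)) / (A t * (1 - A t ^ 2))) = f2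
  generalize ((B t * g (B t) - (1 - 3 * B t ^ 2) * g1 (B t)) / (B t * (1 - B t ^ 2))) = g2
  push_cast
  ring

lemma curveY (A B f f1 g g1 : ℂ → ℂ) (dA dB t : ℂ) (hA : HasDerivAt A dA t) (hB : HasDerivAt B dB t)
    (hf : SolAt f f1 (A t)) (hg : SolAt g g1 (B t)) (h1 : 1 + A t * B t ≠ 0) (h2 : 1 - A t * B t ≠ 0) :
    HasDerivAt (fun t => Gy (A t) (B t) (f (A t)) (f1 (A t)) (g (B t)) (g1 (B t)))
      (dGy (A t) (B t) (f (A t)) (f1 (A t))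
        ((A t * f (A t) - (1 - 3 * A t ^ 2) * f1 (A t)) / (A t * (1 - A t ^ 2)))
        (g (B t)) (g1 (B t))
        ((B t * g (B t) - (1 - 3 * B t ^ 2) * g1 (B t)) / (B t * (1 - B t ^ 2))) dA dB) t := by
  have e1 := hf.1.comp t hA
  have e2 := hg.1.comp t hB
  have e3 := hf.2.comp t hA
  have e4 := hg.2.comp t hB
  have hden : (2 * (1 - A t * B t) * (1 + A t * B t)) ≠ 0 := by simp [h1, h2]
  have n1 := ((hA.add hB).pow 3).div
    ((((hA.mul hB).const_sub 1).const_mul 2).mul ((hA.mul hB).const_add 1)) hden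
  have n2 := ((e1.mul e2).add ((hA.mul e3).mul e2)).add ((hB.mul e1).mul e4)
  refine (n1.mul n2).congr_deriv ?_
  simp only [Function.comp, Pi.add_apply, Pi.mul_apply, Pi.div_apply, Pi.pow_apply, dGy]
  generalize ((A t * f (A t) - (1 - 3 * A t ^ 2) * f1 (A t)) / (A t * (1 - A t ^ 2))) = f2
  generalize ((B t * g (B t) - (1 - 3 * B t ^ 2) * g1 (B t)) / (B t * (1 - B t ^ 2))) = g2
  push_cast
  ring

noncomputable def ax (a b : ℂ) : ℂ := (1 - a ^ 2) * (a + b) ^ 2 / (4 * (b - a) * (1 - a * b))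
noncomputable def bx (a b : ℂ) : ℂ := -((1 - b ^ 2) * (a + b) ^ 2 / (4 * (b - a) * (1 - a * b)))
noncomputable def ay (a b : ℂ) : ℂ := a * (a + b) ^ 2 / (2 * (1 - a * b) * (1 + a * b))
noncomputable def bY (a b : ℂ) : ℂ := b * (a + b) ^ 2 / (2 * (1 - a * b) * (1 + a * b))

lemma Gx_eq (a b f f1 g g1 : ℂ) (h1 : b - a ≠ 0) (h2 : 1 - a * b ≠ 0) :
   ((ax a b + bx a b) * f * g + (a + b) * (f1 * ax a b) * g
        + (a + b) * f * (g1 * bx a b)) = Gx a b f f1 g g1 := by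
  unfold ax bx Gx
  field_simp
  ring

lemma Gy_eq (a b f f1 g g1 : ℂ) (h1 : 1 + a * b ≠ 0) (h2 : 1 - a * b ≠ 0) :
   ((ay a b + bY a b) * f * g + (a + b) * (f1 * ay a b) * g
        + (a + b) * f * (g1 * bY a b)) = Gy a b f f1 g g1 := by
  unfold ay bY Gy
  field_simp

set_option maxHeartbeats 4000000 in
lemma alg1 (a b f f1 f2 g g1 g2 : ℂ) (h1 : b - a ≠ 0) (h2 : 1 - a * b ≠ 0) (h3 : 1 + a * b ≠ 0)
    (h4 : a + b ≠ 0) (h5 : a ≠ 0) (h6 : b ≠ 0) (h7 : 1 - a ^ 2 ≠ 0) (h8 : 1 - b ^ 2 ≠ 0)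
    (hf : f2 = (a * f - (1 - 3 * a ^ 2) * f1) / (a * (1 - a ^ 2)))
    (hg : g2 = (b * g - (1 - 3 * b ^ 2) * g1) / (b * (1 - b ^ 2))) (x y : ℂ)
    (hx : x = 4 * a * b / (a + b) ^ 2) (hy : y = -((1 - a ^ 2) * (1 - b ^ 2) / (a + b) ^ 2)) :
    x * (1 - x) * dGx a b f f1 f2 g g1 g2 (ax a b) (bx a b)
      - x * y * dGx a b f f1 f2 g g1 g2 (ay a b) (bY a b)
      + (1 - 2 * x) * Gx a b f f1 g g1 - 1 / 2 * y * Gy a b f f1 g g1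
      - 1 / 4 * ((a + b) * f * g) = 0 := by
  subst hf hg hx hy
  unfold dGx ax bx ay bY Gx Gy
  field_simp
  ring

set_option maxHeartbeats 4000000 in
lemma alg2 (a b f f1 f2 g g1 g2 : ℂ) (h1 : b - a ≠ 0) (h2 : 1 - a * b ≠ 0) (h3 : 1 + a * b ≠ 0)
    (h4 : a + b ≠ 0) (h5 : a ≠ 0) (h6 : b ≠ 0) (h7 : 1 - a ^ 2 ≠ 0) (h8 : 1 - b ^ 2 ≠ 0)
    (hf : f2 = (a * f - (1 - 3 * a ^ 2) * f1) / (a * (1 - a ^ 2)))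
    (hg : g2 = (b * g - (1 - 3 * b ^ 2) * g1) / (b * (1 - b ^ 2))) (x y : ℂ)
    (hx : x = 4 * a * b / (a + b) ^ 2) (hy : y = -((1 - a ^ 2) * (1 - b ^ 2) / (a + b) ^ 2)) :
    y * (1 - y) * dGy a b f f1 f2 g g1 g2 (ay a b) (bY a b)
      - x * y * dGx a b f f1 f2 g g1 g2 (ay a b) (bY a b)
      + (1 - 2 * y) * Gy a b f f1 g g1 - 1 / 2 * x * Gx a b f f1 g g1
      - 1 / 4 * ((a + b) * f * g) = 0 := by
  subst hf hg hx hy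
  unfold dGx dGy ay bY Gx Gy
  field_simp
  ring

noncomputable def Tc (p : ℂ × ℂ) : ℂ × ℂ :=
  (4 * p.1 * p.2 / (p.1 + p.2) ^ 2, -((1 - p.1 ^ 2) * (1 - p.2 ^ 2) / (p.1 + p.2) ^ 2))

/-- the linear map with a given 2×2 matrix -/
noncomputable def Mat (a b c d : ℂ) : ℂ × ℂ →L[ℂ] ℂ × ℂ :=
  (a • ContinuousLinearMap.fst ℂ ℂ ℂ + b • ContinuousLinearMap.snd ℂ ℂ ℂ).prod
    (c • ContinuousLinearMap.fst ℂ ℂ ℂ + d • ContinuousLinearMap.snd ℂ ℂ ℂ)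

lemma Mat_apply (a b c d : ℂ) (v : ℂ × ℂ) : Mat a b c d v = (a * v.1 + b * v.2, c * v.1 + d * v.2) := by
  simp [Mat]

def Good (p : ℂ × ℂ) : Prop :=
  p.2 - p.1 ≠ 0 ∧ 1 - p.1 * p.2 ≠ 0 ∧ 1 + p.1 * p.2 ≠ 0 ∧ p.1 + p.2 ≠ 0 ∧ p.1 ≠ 0 ∧ p.2 ≠ 0 ∧
    1 - p.1 ^ 2 ≠ 0 ∧ 1 - p.2 ^ 2 ≠ 0

noncomputable def TD (a b : ℂ) : ℂ × ℂ →L[ℂ] ℂ × ℂ :=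
  Mat (4 * b * (b - a) / (a + b) ^ 3) (4 * a * (a - b) / (a + b) ^ 3)
    (2 * (1 - b ^ 2) * (1 + a * b) / (a + b) ^ 3) (2 * (1 - a ^ 2) * (1 + a * b) / (a + b) ^ 3)

lemma Tc_hasFDerivAt (p : ℂ × ℂ) (hp : p.1 + p.2 ≠ 0) : HasFDerivAt Tc (TD p.1 p.2) p := by
  have h1 : HasFDerivAt (fun p : ℂ × ℂ => p.1) (ContinuousLinearMap.fst ℂ ℂ ℂ) p := hasFDerivAt_fst
  have h2 : HasFDerivAt (fun p : ℂ × ℂ => p.2) (ContinuousLinearMap.snd ℂ ℂ ℂ) p := hasFDerivAt_snd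
  have hd : HasFDerivAt (fun p : ℂ × ℂ => ((p.1 + p.2) ^ 2)⁻¹) _ p :=
    (hasDerivAt_inv (pow_ne_zero 2 hp)).comp_hasFDerivAt p ((h1.add h2).pow 2)
  have hx := ((h1.const_mul 4).mul h2).mul hd
  have hy := ((((h1.pow 2).const_sub 1).mul ((h2.pow 2).const_sub 1)).mul hd).neg
  refine (hx.prodMk hy).congr_fderiv ?_
  ext <;> simp [TD, Mat_apply] <;> field_simp <;> ring

lemma Tc_contDiffAt (p : ℂ × ℂ) (hp : p.1 + p.2 ≠ 0) : ContDiffAt ℂ 1 Tc p := by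
  unfold Tc
  have : (p.1 + p.2) ^ 2 ≠ 0 := pow_ne_zero 2 hp
  fun_prop (disch := assumption)

noncomputable def TE (p : ℂ × ℂ) (hp : Good p) : (ℂ × ℂ) ≃L[ℂ] (ℂ × ℂ) :=
  ContinuousLinearEquiv.equivOfInverse (TD p.1 p.2)
    (Mat (ax p.1 p.2) (ay p.1 p.2) (bx p.1 p.2) (bY p.1 p.2))
    (by
      obtain ⟨h1, h2, h3, h4, -⟩ := hp
      obtain ⟨a, b⟩ := p
      rintro ⟨u, w⟩
      dsimp only at h1 h2 h3 h4
      have h2' : 1 - b * a ≠ 0 := by rwa [mul_comm]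
      have h3' : 1 + b * a ≠ 0 := by rwa [mul_comm]
      simp only [TD, Mat_apply, ax, ay, bx, bY]
      apply Prod.ext
      · simp only; field_simp; ring
      · simp only; field_simp; ring)
    (by
      obtain ⟨h1, h2, h3, h4, -⟩ := hp
      obtain ⟨a, b⟩ := p
      rintro ⟨u, w⟩
      dsimp only at h1 h2 h3 h4
      have h2' : 1 - b * a ≠ 0 := by rwa [mul_comm]
      have h3' : 1 + b * a ≠ 0 := by rwa [mul_comm]
      simp only [TD, Mat_apply, ax, ay, bx, bY]
      apply Prod.ext
      · simp only; field_simp; ring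
      · simp only; field_simp; ring)

lemma good_isOpen : IsOpen {p | Good p} := by
  unfold Good
  simp only [Set.ofPred_and]
  repeat' apply IsOpen.inter
  all_goals exact isOpen_ne_fun (by fun_prop) (by fun_prop)

/-- The general statement for products of solutions. -/
lemma general (f f1 g g1 : ℂ → ℂ) (c : ℂ) (N : Set ℂ) (hN : IsOpen N)
    (hf : ∀ k ∈ N, k ≠ 0 → 1 - k ^ 2 ≠ 0 → SolAt f f1 k)
    (hg : ∀ k ∈ N, k ≠ 0 → 1 - k ^ 2 ≠ 0 → SolAt g g1 k)
    (p0 : ℂ × ℂ) (hp0 : Good p0) (h01 : p0.1 ∈ N) (h02 : p0.2 ∈ N) :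
    ∃ U : Set (ℂ × ℂ), IsOpen U ∧ Tc p0 ∈ U ∧
      ∃ F : ℂ → ℂ → ℂ,
        DifferentiableOn ℂ (fun p : ℂ × ℂ => F p.1 p.2) U ∧
        (∀ p ∈ U,
          p.1 * (1 - p.1) * dX (dX F) p.1 p.2
            - p.1 * p.2 * dY (dX F) p.1 p.2
            + (1 - 2 * p.1) * dX F p.1 p.2
            - (1 / 2) * p.2 * dY F p.1 p.2
            - (1 / 4) * F p.1 p.2 = 0) ∧
        (∀ p ∈ U,
          p.2 * (1 - p.2) * dY (dY F) p.1 p.2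
            - p.1 * p.2 * dY (dX F) p.1 p.2
            + (1 - 2 * p.2) * dY F p.1 p.2
            - (1 / 2) * p.1 * dX F p.1 p.2
            - (1 / 4) * F p.1 p.2 = 0) ∧
        ∃ V : Set (ℂ × ℂ), IsOpen V ∧ p0 ∈ V ∧
          (∀ q ∈ V, Tc q ∈ U) ∧
          ∀ q ∈ V, F (Tc q).1 (Tc q).2 = c * ((q.1 + q.2) * f q.1 * g q.2) := by
  have hd0 : HasFDerivAt Tc (TE p0 hp0 : ℂ × ℂ →L[ℂ] ℂ × ℂ) p0 := Tc_hasFDerivAt p0 hp0.2.2.2.1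
  set e := (Tc_contDiffAt p0 hp0.2.2.2.1).toOpenPartialHomeomorph Tc hd0 one_ne_zero with he
  have he0 : p0 ∈ e.source :=
    (Tc_contDiffAt p0 hp0.2.2.2.1).mem_toOpenPartialHomeomorph_source hd0 one_ne_zero
  have hecoe : (e : ℂ × ℂ → ℂ × ℂ) = Tc := rfl
  set W : Set (ℂ × ℂ) := {p | Good p} ∩ N ×ˢ N with hW
  have hWo : IsOpen W := good_isOpen.inter (hN.prod hN)
  set U : Set (ℂ × ℂ) := e.target ∩ e.symm ⁻¹' W with hU
  have hUo : IsOpen U := e.symm.isOpen_inter_preimage hWo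
  have hS : ∀ p ∈ U, HasFDerivAt e.symm
      (Mat (ax (e.symm p).1 (e.symm p).2) (ay (e.symm p).1 (e.symm p).2)
        (bx (e.symm p).1 (e.symm p).2) (bY (e.symm p).1 (e.symm p).2)) p := by
    intro p hp
    have hgood : Good (e.symm p) := hp.2.1
    exact e.hasFDerivAt_symm (f' := TE _ hgood) hp.1 (Tc_hasFDerivAt _ hgood.2.2.2.1)
  have hAx : ∀ x y, (x, y) ∈ U → HasDerivAt (fun t => (e.symm (t, y)).1)
      (ax (e.symm (x, y)).1 (e.symm (x, y)).2) x := by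
    intro x y hp
    have h := (hS _ hp).comp_hasDerivAt x ((hasDerivAt_id x).prodMk (hasDerivAt_const x y))
    have h' := (hasFDerivAt_fst (𝕜 := ℂ)).comp_hasDerivAt _ h
    simpa [Mat_apply, Function.comp_def] using h'
  have hBx : ∀ x y, (x, y) ∈ U → HasDerivAt (fun t => (e.symm (t, y)).2)
      (bx (e.symm (x, y)).1 (e.symm (x, y)).2) x := by
    intro x y hp
    have h := (hS _ hp).comp_hasDerivAt x ((hasDerivAt_id x).prodMk (hasDerivAt_const x y))
    have h' := (hasFDerivAt_snd (𝕜 := ℂ)).comp_hasDerivAt _ h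
    simpa [Mat_apply, Function.comp_def] using h'
  have hAy : ∀ x y, (x, y) ∈ U → HasDerivAt (fun t => (e.symm (x, t)).1)
      (ay (e.symm (x, y)).1 (e.symm (x, y)).2) y := by
    intro x y hp
    have h := (hS _ hp).comp_hasDerivAt y ((hasDerivAt_const y x).prodMk (hasDerivAt_id y))
    have h' := (hasFDerivAt_fst (𝕜 := ℂ)).comp_hasDerivAt _ h
    simpa [Mat_apply, Function.comp_def] using h'
  have hBy : ∀ x y, (x, y) ∈ U → HasDerivAt (fun t => (e.symm (x, t)).2)
      (bY (e.symm (x, y)).1 (e.symm (x, y)).2) y := by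
    intro x y hp
    have h := (hS _ hp).comp_hasDerivAt y ((hasDerivAt_const y x).prodMk (hasDerivAt_id y))
    have h' := (hasFDerivAt_snd (𝕜 := ℂ)).comp_hasDerivAt _ h
    simpa [Mat_apply, Function.comp_def] using h'
  have hfU : ∀ p ∈ U, SolAt f f1 (e.symm p).1 := fun p hp =>
    hf _ hp.2.2.1 hp.2.1.2.2.2.2.1 hp.2.1.2.2.2.2.2.2.1
  have hgU : ∀ p ∈ U, SolAt g g1 (e.symm p).2 := fun p hp =>
    hg _ hp.2.2.2 hp.2.1.2.2.2.2.2.1 hp.2.1.2.2.2.2.2.2.2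
  have hnx : ∀ x y, (x, y) ∈ U → ∀ᶠ t in nhds x, (t, y) ∈ U := fun x y h =>
    (show ContinuousAt (fun t : ℂ => (t, y)) x by fun_prop).eventually (hUo.mem_nhds h)
  have hny : ∀ x y, (x, y) ∈ U → ∀ᶠ t in nhds y, (x, t) ∈ U := fun x y h =>
    (show ContinuousAt (fun t : ℂ => (x, t)) y by fun_prop).eventually (hUo.mem_nhds h)
  set F : ℂ → ℂ → ℂ := fun x y =>
    c * (((e.symm (x, y)).1 + (e.symm (x, y)).2) * f (e.symm (x, y)).1 * g (e.symm (x, y)).2) with hF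
  have dXF : ∀ x y, (x, y) ∈ U → dX F x y = c * Gx (e.symm (x, y)).1 (e.symm (x, y)).2
      (f (e.symm (x, y)).1) (f1 (e.symm (x, y)).1) (g (e.symm (x, y)).2) (g1 (e.symm (x, y)).2) := by
    intro x y h
    have := (curve0 _ _ f f1 g g1 _ _ x (hAx x y h) (hBx x y h) (hfU _ h) (hgU _ h)).const_mul c
    rw [Gx_eq _ _ _ _ _ _ h.2.1.1 h.2.1.2.1] at this
    exact this.deriv
  have dYF : ∀ x y, (x, y) ∈ U → dY F x y = c * Gy (e.symm (x, y)).1 (e.symm (x, y)).2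
      (f (e.symm (x, y)).1) (f1 (e.symm (x, y)).1) (g (e.symm (x, y)).2) (g1 (e.symm (x, y)).2) := by
    intro x y h
    have := (curve0 _ _ f f1 g g1 _ _ y (hAy x y h) (hBy x y h) (hfU _ h) (hgU _ h)).const_mul c
    rw [Gy_eq _ _ _ _ _ _ h.2.1.2.2.1 h.2.1.2.1] at this
    exact this.deriv
  have dXXF : ∀ x y, (h : (x, y) ∈ U) → dX (dX F) x y = _ := fun x y h =>
    (((curveX _ _ f f1 g g1 _ _ x (hAx x y h) (hBx x y h) (hfU _ h) (hgU _ h)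
      h.2.1.1 h.2.1.2.1).const_mul c).congr_of_eventuallyEq
        ((hnx x y h).mono fun t ht => dXF t y ht)).deriv
  have dYXF : ∀ x y, (h : (x, y) ∈ U) → dY (dX F) x y = _ := fun x y h =>
    (((curveX _ _ f f1 g g1 _ _ y (hAy x y h) (hBy x y h) (hfU _ h) (hgU _ h)
      h.2.1.1 h.2.1.2.1).const_mul c).congr_of_eventuallyEq
        ((hny x y h).mono fun t ht => dXF x t ht)).deriv
  have dYYF : ∀ x y, (h : (x, y) ∈ U) → dY (dY F) x y = _ := fun x y h =>
    (((curveY _ _ f f1 g g1 _ _ y (hAy x y h) (hBy x y h) (hfU _ h) (hgU _ h)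
      h.2.1.2.2.1 h.2.1.2.1).const_mul c).congr_of_eventuallyEq
        ((hny x y h).mono fun t ht => dYF x t ht)).deriv
  have hxy : ∀ p ∈ U, p = Tc (e.symm p) := fun p hp => (e.right_inv hp.1).symm
  refine ⟨U, hUo, ?_, F, ?_, ?_, ?_, e.source ∩ W, e.open_source.inter hWo, ⟨he0, hp0, h01, h02⟩,
    ?_, ?_⟩
  · refine ⟨e.map_source he0, ?_⟩
    change e.symm (e p0) ∈ W
    rw [e.left_inv he0]
    exact ⟨hp0, h01, h02⟩
  · intro p hp
    have hs := (hS p hp).differentiableAt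
    have hs1 : DifferentiableAt ℂ (fun p => (e.symm p).1) p := hs.fst
    have hs2 : DifferentiableAt ℂ (fun p => (e.symm p).2) p := hs.snd
    have hf' : DifferentiableAt ℂ (fun p => f (e.symm p).1) p :=
      (hfU p hp).1.differentiableAt.comp p hs1
    have hg' : DifferentiableAt ℂ (fun p => g (e.symm p).2) p :=
      (hgU p hp).1.differentiableAt.comp p hs2
    exact ((((hs1.add hs2).mul hf').mul hg').const_mul c).differentiableWithinAt
  · rintro ⟨x, y⟩ hp
    obtain ⟨k1, k2, k3, k4, k5, k6, k7, k8⟩ := hp.2.1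
    have hT := hxy _ hp
    have := alg1 _ _ (f (e.symm (x, y)).1) (f1 (e.symm (x, y)).1) _
      (g (e.symm (x, y)).2) (g1 (e.symm (x, y)).2) _ k1 k2 k3 k4 k5 k6 k7 k8 rfl rfl x y
      (congrArg Prod.fst hT) (congrArg Prod.snd hT)
    simp only
    rw [dXXF x y hp, dYXF x y hp, dXF x y hp, dYF x y hp]
    simp only [hF]
    linear_combination c * this
  · rintro ⟨x, y⟩ hp
    obtain ⟨k1, k2, k3, k4, k5, k6, k7, k8⟩ := hp.2.1
    have hT := hxy _ hp
    have := alg2 _ _ (f (e.symm (x, y)).1) (f1 (e.symm (x, y)).1) _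
      (g (e.symm (x, y)).2) (g1 (e.symm (x, y)).2) _ k1 k2 k3 k4 k5 k6 k7 k8 rfl rfl x y
      (congrArg Prod.fst hT) (congrArg Prod.snd hT)
    simp only
    rw [dYYF x y hp, dYXF x y hp, dXF x y hp, dYF x y hp]
    simp only [hF]
    linear_combination c * this
  · intro q hq
    refine ⟨e.map_source hq.1, ?_⟩
    change e.symm (e q) ∈ W
    rw [e.left_inv hq.1]
    exact hq.2
  · intro q hq
    have : e.symm (Tc q) = q := e.left_inv hq.1
    simp only [hF, Prod.mk.eta, this]

noncomputable def K0 (k : ℂ) : ℂ := ellipticKC (k ^ 2)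
noncomputable def K0d (k : ℂ) : ℂ := (Real.pi : ℂ) / 2 * (h1 (k ^ 2) * (2 * k))
noncomputable def K1 (k : ℂ) : ℂ := ellipticKC (1 - k ^ 2)
noncomputable def K1d (k : ℂ) : ℂ := (Real.pi : ℂ) / 2 * (h1 (1 - k ^ 2) * (-(2 * k)))

lemma K0_sol (k : ℂ) (hk : ‖k ^ 2‖ < 1) (h : k ≠ 0) (h' : 1 - k ^ 2 ≠ 0) : SolAt K0 K0d k := by
  have d : HasDerivAt (fun k : ℂ => k ^ 2) (2 * k) k := by simpa using hasDerivAt_pow 2 k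
  have d' : HasDerivAt (fun k : ℂ => 2 * k) 2 k := by simpa using (hasDerivAt_id k).const_mul 2
  have ode := h_ode _ hk
  refine ⟨((h0_deriv _ hk).comp k d).const_mul _, ?_⟩
  refine ((((h1_deriv _ hk).comp k d).mul d').const_mul ((Real.pi : ℂ) / 2)).congr_deriv ?_
  rw [eq_div_iff (mul_ne_zero h h')]
  simp only [K0, K0d, ellipticKC, Function.comp]
  change _ = k * ((Real.pi : ℂ) / 2 * h0 (k ^ 2)) - _
  linear_combination (Real.pi : ℂ) / 2 * 4 * k * ode

lemma K1_sol (k : ℂ) (hk : ‖1 - k ^ 2‖ < 1) (h : k ≠ 0) (h' : 1 - k ^ 2 ≠ 0) : SolAt K1 K1d k := by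
  have d : HasDerivAt (fun k : ℂ => 1 - k ^ 2) (-(2 * k)) k := by
    simpa using (hasDerivAt_pow 2 k).const_sub 1
  have d' : HasDerivAt (fun k : ℂ => -(2 * k)) (-2) k := by
    simpa using (hasDerivAt_id k).const_mul (-2 : ℂ)
  have ode := h_ode _ hk
  refine ⟨((h0_deriv _ hk).comp k d).const_mul _, ?_⟩
  refine ((((h1_deriv _ hk).comp k d).mul d').const_mul ((Real.pi : ℂ) / 2)).congr_deriv ?_
  rw [eq_div_iff (mul_ne_zero h h')]
  simp only [K1, K1d, ellipticKC, Function.comp]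
  change _ = k * ((Real.pi : ℂ) / 2 * h0 (1 - k ^ 2)) - _
  linear_combination (Real.pi : ℂ) / 2 * 4 * k * ode

lemma trainPeriod_eq (j : Fin 4) : ∃ (f f1 g g1 : ℂ → ℂ) (c : ℂ),
    (∀ k : ℂ, ‖k ^ 2‖ < 1 ∧ ‖1 - k ^ 2‖ < 1 → k ≠ 0 → 1 - k ^ 2 ≠ 0 → SolAt f f1 k) ∧
    (∀ k : ℂ, ‖k ^ 2‖ < 1 ∧ ‖1 - k ^ 2‖ < 1 → k ≠ 0 → 1 - k ^ 2 ≠ 0 → SolAt g g1 k) ∧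
    ∀ a b : ℝ, trainPeriod j a b = c * (((a : ℂ) + b) * f a * g b) := by
  have s0 : ∀ k : ℂ, ‖k ^ 2‖ < 1 ∧ ‖1 - k ^ 2‖ < 1 → k ≠ 0 → 1 - k ^ 2 ≠ 0 → SolAt K0 K0d k :=
    fun k hk h h' => K0_sol k hk.1 h h'
  have s1 : ∀ k : ℂ, ‖k ^ 2‖ < 1 ∧ ‖1 - k ^ 2‖ < 1 → k ≠ 0 → 1 - k ^ 2 ≠ 0 → SolAt K1 K1d k :=
    fun k hk h h' => K1_sol k hk.2 h h'
  fin_cases j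
  · refine ⟨K0, K0d, K1, K1d, 4 / (Real.pi : ℂ) ^ 2, s0, s1, fun a b => ?_⟩
    simp only [trainPeriod, K0, K1]; ring
  · refine ⟨K1, K1d, K1, K1d, 4 * Complex.I / (Real.pi : ℂ) ^ 2, s1, s1, fun a b => ?_⟩
    simp only [trainPeriod, K1]; ring
  · refine ⟨K0, K0d, K0, K0d, 4 * Complex.I / (Real.pi : ℂ) ^ 2, s0, s0, fun a b => ?_⟩
    simp only [trainPeriod, K0]; ring
  · refine ⟨K1, K1d, K0, K0d, -(4 / (Real.pi : ℂ) ^ 2), s1, s0, fun a b => ?_⟩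
    simp only [trainPeriod, K0, K1]; ring

lemma Tc_ofReal (a b : ℝ) : Tc ((a : ℂ), (b : ℂ)) = Tcdm a b := by
  simp [Tc, Tcdm]

lemma real_mem (a : ℝ) (h : a ∈ Set.Ioo (0 : ℝ) 1) :
    ‖(a : ℂ) ^ 2‖ < 1 ∧ ‖1 - (a : ℂ) ^ 2‖ < 1 := by
  obtain ⟨h0, h1⟩ := h
  have e : (1 - (a : ℂ) ^ 2) = ((1 - a ^ 2 : ℝ) : ℂ) := by push_cast; rfl
  have e' : (a : ℂ) ^ 2 = ((a ^ 2 : ℝ) : ℂ) := by push_cast; rfl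
  rw [e, e', Complex.norm_real, Complex.norm_real, Real.norm_of_nonneg (by positivity),
    Real.norm_of_nonneg (by nlinarith)]
  constructor <;> nlinarith

lemma real_good (a b : ℝ) (ha : a ∈ Set.Ioo (0 : ℝ) 1) (hb : b ∈ Set.Ioo (0 : ℝ) 1) (hne : a ≠ b) :
    Good ((a : ℂ), (b : ℂ)) := by
  obtain ⟨a0, a1⟩ := ha
  obtain ⟨b0, b1⟩ := hb
  unfold Good
  dsimp only
  refine ⟨?_, ?_, ?_, ?_, ?_, ?_, ?_, ?_⟩
  · exact_mod_cast sub_ne_zero.2 hne.symm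
  · exact_mod_cast (show (1 - a * b : ℝ) ≠ 0 by nlinarith)
  · exact_mod_cast (show (1 + a * b : ℝ) ≠ 0 by positivity)
  · exact_mod_cast (show (a + b : ℝ) ≠ 0 by positivity)
  · exact_mod_cast a0.ne'
  · exact_mod_cast b0.ne'
  · exact_mod_cast (show (1 - a ^ 2 : ℝ) ≠ 0 by nlinarith)
  · exact_mod_cast (show (1 - b ^ 2 : ℝ) ≠ 0 by nlinarith)

/-- Each of the four period functions `Π_j` is, locally around any point
`(Λ₁⁰,Λ₂⁰) ∈ (0,1)²` with `Λ₁⁰ ≠ Λ₂⁰`, the pullback under the Clingher–Doran–Malmendier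
map `T` of a holomorphic solution of the Appell `F₂` system with parameters
`α = 1/2`, `β₁ = β₂ = 1/2`, `γ₁ = γ₂ = 1`. -/
theorem trainPeriods_solve_appellF2_system
    (Λ₁0 Λ₂0 : ℝ) (h₁ : Λ₁0 ∈ Set.Ioo (0 : ℝ) 1) (h₂ : Λ₂0 ∈ Set.Ioo (0 : ℝ) 1)
    (hne : Λ₁0 ≠ Λ₂0) (j : Fin 4) :
    ∃ U : Set (ℂ × ℂ), IsOpen U ∧ Tcdm Λ₁0 Λ₂0 ∈ U ∧
      ∃ F : ℂ → ℂ → ℂ,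
        DifferentiableOn ℂ (fun p : ℂ × ℂ => F p.1 p.2) U ∧
        (∀ p ∈ U,
          p.1 * (1 - p.1) * dX (dX F) p.1 p.2
            - p.1 * p.2 * dY (dX F) p.1 p.2
            + (1 - 2 * p.1) * dX F p.1 p.2
            - (1 / 2) * p.2 * dY F p.1 p.2
            - (1 / 4) * F p.1 p.2 = 0) ∧
        (∀ p ∈ U,
          p.2 * (1 - p.2) * dY (dY F) p.1 p.2
            - p.1 * p.2 * dY (dX F) p.1 p.2
            + (1 - 2 * p.2) * dY F p.1 p.2
            - (1 / 2) * p.1 * dX F p.1 p.2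
            - (1 / 4) * F p.1 p.2 = 0) ∧
        ∃ V : Set (ℝ × ℝ), IsOpen V ∧ (Λ₁0, Λ₂0) ∈ V ∧
          (∀ q ∈ V, Tcdm q.1 q.2 ∈ U) ∧
          ∀ q ∈ V, F (Tcdm q.1 q.2).1 (Tcdm q.1 q.2).2 = trainPeriod j q.1 q.2 := by
  obtain ⟨f, f1, g, g1, c, hf, hg, hP⟩ := trainPeriod_eq j
  have hN : IsOpen {k : ℂ | ‖k ^ 2‖ < 1 ∧ ‖1 - k ^ 2‖ < 1} := by
    rw [Set.ofPred_and]
    exact (isOpen_lt (by fun_prop) (by fun_prop)).inter (isOpen_lt (by fun_prop) (by fun_prop))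
  obtain ⟨U, hU, hT, F, hF, e1, e2, V, hV, h0V, hVU, hVF⟩ :=
    general f f1 g g1 c _ hN hf hg ((Λ₁0 : ℂ), (Λ₂0 : ℂ)) (real_good _ _ h₁ h₂ hne)
      (real_mem _ h₁) (real_mem _ h₂)
  refine ⟨U, hU, by rwa [← Tc_ofReal], F, hF, e1, e2,
    (fun q : ℝ × ℝ => ((q.1 : ℂ), (q.2 : ℂ))) ⁻¹' V, hV.preimage (by fun_prop), h0V, ?_, ?_⟩
  · intro q hq
    rw [← Tc_ofReal]
    exact hVU _ hq
  · intro q hq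
    rw [← Tc_ofReal, hP]
    exact hVF _ hq
end

section
/- Let z ∈ ℝ with 0 < z < 1, and set τ = i·K(1−z)/K(z); since K(z) and K(1−z) are positive reals, τ lies in the upper half-plane. Then λ(τ) = z, where λ(τ) = θ₂(τ)⁴/θ₃(τ)⁴. That is, the mirror map z ↦ i·K(1−z)/K(z) inverts the Hauptmodul λ of Γ(2). -/
/-- The Pochhammer symbol (rising factorial) `(a)_n = a (a+1) ⋯ (a+n-1)`. -/
noncomputable def pochR (a : ℝ) (n : ℕ) : ℝ := ∏ i ∈ Finset.range n, (a + i)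

/-- The Gauss hypergeometric function `₂F₁(a,b;c;z)` (real), defined by its series. -/
noncomputable def hyp2F1R (a b c z : ℝ) : ℝ :=
  ∑' n : ℕ, pochR a n * pochR b n / (pochR c n * n.factorial) * z ^ n

/-- The complete elliptic integral of the first kind `K(z) = (π/2)·₂F₁(1/2,1/2;1;z)`,
real and positive for `z ∈ (0,1)`. -/
noncomputable def ellipticK (z : ℝ) : ℝ := Real.pi / 2 * hyp2F1R (1 / 2) (1 / 2) 1 z

/-- The Jacobi theta constant `θ₂(τ) = ∑_{n∈ℤ} exp(iπτ(n+1/2)²)`. -/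
noncomputable def theta2 (τ : ℂ) : ℂ :=
  ∑' n : ℤ, Complex.exp (Real.pi * Complex.I * τ * ((n : ℂ) + 1 / 2) ^ 2)

/-- The Jacobi theta constant `θ₃(τ) = ∑_{n∈ℤ} exp(iπτ n²)`. -/
noncomputable def theta3 (τ : ℂ) : ℂ :=
  ∑' n : ℤ, Complex.exp (Real.pi * Complex.I * τ * (n : ℂ) ^ 2)

/-- The modular lambda function `λ(τ) = θ₂(τ)⁴/θ₃(τ)⁴`. -/
noncomputable def modularLambda (τ : ℂ) : ℂ := theta2 τ ^ 4 / theta3 τ ^ 4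


noncomputable def cco (n : ℕ) : ℝ := ∏ i ∈ Finset.range n, (2 * (i : ℝ) + 1) / (2 * i + 2)

lemma cco_succ (n : ℕ) : cco (n+1) = cco n * ((2 * (n : ℝ) + 1) / (2 * n + 2)) := by
  rw [cco, Finset.prod_range_succ, ← cco]

lemma cco_pos (n : ℕ) : 0 < cco n := Finset.prod_pos fun i _ => by positivity

lemma cco_le_one (n : ℕ) : cco n ≤ 1 := by
  refine Finset.prod_le_one (fun i _ => by positivity) fun i _ => ?_
  rw [div_le_one (by positivity)]; linarith

lemma pochR_half (n : ℕ) : pochR (1/2) n = cco n * n.factorial := by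
  induction n with
  | zero => simp [pochR, cco]
  | succ n ih =>
    rw [cco_succ, Nat.factorial_succ, pochR, Finset.prod_range_succ, ← pochR, ih]
    push_cast
    field_simp
    ring

lemma pochR_one (n : ℕ) : pochR 1 n = n.factorial := by
  induction n with
  | zero => simp [pochR]
  | succ n ih =>
    rw [Nat.factorial_succ, pochR, Finset.prod_range_succ, ← pochR, ih]
    push_cast
    ring

noncomputable def FF (z : ℝ) : ℝ := ∑' n : ℕ, cco n ^ 2 * z ^ n

lemma ellipticK_eq (z : ℝ) : ellipticK z = Real.pi / 2 * FF z := by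
  unfold ellipticK hyp2F1R FF
  congr 1
  refine tsum_congr fun n => ?_
  have : (n.factorial : ℝ) ≠ 0 := by positivity
  rw [pochR_half, pochR_one]
  field_simp

lemma choose_half (n : ℕ) : Ring.choose ((1/2 : ℂ) + n - 1) n = (cco n : ℂ) := by
  rw [← Ring.multichoose_eq]
  have h := Ring.factorial_nsmul_multichoose_eq_ascPochhammer (1/2 : ℂ) n
  rw [Polynomial.ascPochhammer_smeval_eq_eval] at h
  have h2 : ∀ n : ℕ, (ascPochhammer ℂ n).eval (1/2 : ℂ) = (cco n : ℂ) * n.factorial := by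
    intro n
    induction n with
    | zero => simp [cco]
    | succ n ih =>
      rw [ascPochhammer_succ_eval, ih, cco_succ, Nat.factorial_succ]
      push_cast
      have : (2 * (n:ℂ) + 2) ≠ 0 := by exact_mod_cast (by positivity : (2 * (n:ℝ) + 2) ≠ 0)
      field_simp
      ring
  rw [h2, nsmul_eq_mul, mul_comm] at h
  exact mul_right_cancel₀ (by exact_mod_cast n.factorial_ne_zero) h

lemma hasSum_binom (w : ℂ) (hw : ‖w‖ < 1) :
    HasSum (fun n : ℕ => (cco n : ℂ) * w ^ n) (1 / (1 - w) ^ (1/2 : ℂ)) := by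
  have h := (Complex.one_div_one_sub_cpow_hasFPowerSeriesOnBall_zero (1/2)).hasSum (y := w)
    (by rw [mem_eball_zero_iff, ← ofReal_norm]; exact ENNReal.ofReal_lt_one.2 hw)
  simp only [zero_add, FormalMultilinearSeries.ofScalars_apply_eq, choose_half] at h
  simpa [mul_comm] using h

lemma hasSum_binom_real (u : ℝ) (h0 : 0 ≤ u) (hu : u < 1) :
    HasSum (fun n : ℕ => cco n * u ^ n) (1 / √(1 - u)) := by
  have h := hasSum_binom u (by simpa [abs_of_nonneg h0] using hu)
  rw [← Complex.hasSum_ofReal]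
  convert h using 1
  · ext; push_cast; rfl
  · rw [Real.sqrt_eq_rpow]
    push_cast [Complex.ofReal_cpow (by linarith : 0 ≤ 1 - u)]
    rfl

lemma summable_cco (x : ℝ) (h0 : 0 ≤ x) (hx : x < 1) : Summable (fun n : ℕ => cco n * x ^ n) :=
  (hasSum_binom_real x h0 hx).summable

/-- first integral -/
lemma int_one (k : ℝ) (h0 : 0 ≤ k) (hk : k < 1) :
    ∫ φ in (0:ℝ)..Real.pi, 1 / √(1 - k * Real.sin φ ^ 2) = Real.pi * FF k := by
  have hs : ∀ φ, Real.sin φ ^ 2 ≤ 1 := Real.sin_sq_le_one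
  have H := intervalIntegral.hasSum_intervalIntegral_of_summable_norm (a := 0) (b := Real.pi)
    (f := fun n : ℕ => (⟨fun φ => cco n * (k * Real.sin φ ^ 2) ^ n, by fun_prop⟩ : C(ℝ, ℝ))) (by
      refine Summable.of_nonneg_of_le (fun _ => norm_nonneg _) (fun n => ?_) (summable_cco k h0 hk)
      have := cco_pos n
      refine (ContinuousMap.norm_le _ (by positivity)).2 fun φ => ?_
      simp only [ContinuousMap.restrict_apply, ContinuousMap.coe_mk]
      rw [Real.norm_of_nonneg (by positivity)]
      gcongr
      nlinarith [hs φ])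
  simp only [ContinuousMap.coe_mk] at H
  have e1 : ∀ φ, ∑' n : ℕ, cco n * (k * Real.sin φ ^ 2) ^ n = 1 / √(1 - k * Real.sin φ ^ 2) :=
    fun φ => (hasSum_binom_real _ (by positivity) (by nlinarith [hs φ])).tsum_eq
  simp only [e1] at H
  rw [← H.tsum_eq, FF, ← tsum_mul_left]
  refine tsum_congr fun n => ?_
  have : ∀ φ : ℝ, cco n * (k * Real.sin φ ^ 2) ^ n = cco n * k ^ n * Real.sin φ ^ (2 * n) := by
    intro φ; rw [mul_pow, pow_mul]; ring
  simp only [this]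
  rw [intervalIntegral.integral_const_mul, integral_sin_pow_even, ← cco]
  ring

lemma exp_int (m n : ℕ) : ∫ φ in (0:ℝ)..Real.pi,
    Complex.exp (2 * φ * Complex.I) ^ m * Complex.exp (-(2 * φ * Complex.I)) ^ n
      = if m = n then (Real.pi : ℂ) else 0 := by
  have e : ∀ φ : ℝ, Complex.exp (2 * φ * Complex.I) ^ m * Complex.exp (-(2 * φ * Complex.I)) ^ n
    = Complex.exp ((2 * ((m:ℂ) - n) * Complex.I) * φ) := by
    intro φ
    rw [← Complex.exp_nat_mul, ← Complex.exp_nat_mul, ← Complex.exp_add]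
    congr 1; ring
  simp only [e]
  split_ifs with h
  · subst h; simp
  · have hc : (2 * ((m:ℂ) - n) * Complex.I) ≠ 0 := by
      have : (m:ℂ) - n ≠ 0 := sub_ne_zero.2 (by exact_mod_cast h)
      simp [this]
    rw [integral_exp_mul_complex hc]
    have : Complex.exp ((2 * ((m:ℂ) - n) * Complex.I) * Real.pi) = 1 := by
      rw [Complex.exp_eq_one_iff]
      exact ⟨(m:ℤ) - n, by push_cast; ring⟩
    rw [this]; simp

lemma norm_val (x : ℝ) (h0 : 0 ≤ x) (hx : x < 1) (φ : ℝ) :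
    (1 / (1 - (-x : ℂ) * Complex.exp (2 * φ * Complex.I)) ^ (1/2 : ℂ)) *
    (1 / (1 - (-x : ℂ) * Complex.exp (-(2 * φ * Complex.I))) ^ (1/2 : ℂ))
     = ((1 / (1 + x) * (1 / √(1 - 4 * x / (1 + x)^2 * Real.sin φ ^ 2)) : ℝ) : ℂ) := by
  set w : ℂ := 1 - (-x : ℂ) * Complex.exp (2 * φ * Complex.I) with hw
  have hconj : 1 - (-x : ℂ) * Complex.exp (-(2 * φ * Complex.I)) = (starRingEnd ℂ) w := by
    rw [hw, map_sub, map_mul, ← Complex.exp_conj]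
    simp only [map_one, map_mul, map_neg, Complex.conj_ofReal, Complex.conj_I, Complex.conj_ofNat]
    congr 3; ring
  have hre : 0 < w.re := by
    have e : Complex.exp (2 * φ * Complex.I) = Complex.exp ((2 * φ : ℝ) * Complex.I) := by push_cast; rfl
    rw [hw, e]
    simp only [Complex.sub_re, Complex.sub_im, Complex.mul_re, Complex.mul_im, Complex.neg_re, Complex.neg_im, Complex.ofReal_re, Complex.ofReal_im, Complex.exp_ofReal_mul_I_re, Complex.exp_ofReal_mul_I_im, Complex.one_re, Complex.one_im]
    nlinarith [Real.neg_one_le_cos (2*φ)]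
  have hns : Complex.normSq w = (1+x)^2 * (1 - 4 * x / (1 + x)^2 * Real.sin φ ^ 2) := by
    have e : Complex.exp (2 * φ * Complex.I) = Complex.exp ((2 * φ : ℝ) * Complex.I) := by push_cast; rfl
    rw [hw, e, Complex.normSq_apply]
    simp only [Complex.sub_re, Complex.sub_im, Complex.mul_re, Complex.mul_im, Complex.neg_re, Complex.neg_im, Complex.ofReal_re, Complex.ofReal_im, Complex.exp_ofReal_mul_I_re, Complex.exp_ofReal_mul_I_im, Complex.one_re, Complex.one_im]
    have h1 := Real.cos_sq_add_sin_sq (2*φ)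
    have h2 := Real.cos_two_mul φ
    have h3 := Real.cos_sq_add_sin_sq φ
    field_simp
    linear_combination x^2 * h1 + 2 * x * h2 + 4 * x * h3
  have harg : w.arg ≠ Real.pi := by
    intro h; rw [Complex.arg_eq_pi_iff] at h; linarith [h.1]
  have hcp : ((starRingEnd ℂ) w) ^ (1/2 : ℂ) = (starRingEnd ℂ) (w ^ (1/2 : ℂ)) := by
    rw [Complex.conj_cpow _ _ harg, map_div₀, map_one, Complex.conj_ofNat]
  rw [hconj, hcp, one_div_mul_one_div, Complex.mul_conj, ← Complex.sq_norm]
  have hn : ‖w ^ (1/2 : ℂ)‖ ^ 2 = ‖w‖ := by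
    rw [← norm_pow, ← Complex.cpow_nat_mul]; simp
  rw [hn, ← Real.sqrt_sq (norm_nonneg w), Complex.sq_norm, hns, Real.sqrt_mul (by positivity),
    Real.sqrt_sq (by positivity)]
  push_cast
  rw [one_div_mul_one_div]

lemma int_two (x : ℝ) (h0 : 0 ≤ x) (hx : x < 1) :
    ∫ φ in (0:ℝ)..Real.pi, 1 / (1 + x) * (1 / √(1 - 4 * x / (1 + x)^2 * Real.sin φ ^ 2))
      = Real.pi * FF (x^2) := by
  have ne1 : ∀ φ : ℝ, ‖Complex.exp (2 * φ * Complex.I)‖ = 1 := fun φ => by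
    have := Complex.norm_exp_ofReal_mul_I (2*φ); push_cast at this; exact this
  have ne2 : ∀ φ : ℝ, ‖Complex.exp (-(2 * φ * Complex.I))‖ = 1 := fun φ => by
    have := Complex.norm_exp_ofReal_mul_I (-(2*φ)); push_cast at this; rw [neg_mul] at this; exact this
  have nx : ‖(-x : ℂ)‖ = x := by simp [abs_of_nonneg h0]
  set A : ℝ → ℕ → ℂ := fun φ n => (cco n : ℂ) * ((-x : ℂ) * Complex.exp (2 * φ * Complex.I)) ^ n
  set B : ℝ → ℕ → ℂ := fun φ n => (cco n : ℂ) * ((-x : ℂ) * Complex.exp (-(2 * φ * Complex.I))) ^ n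
  have nA : ∀ φ n, ‖A φ n‖ = cco n * x ^ n := by
    intro φ n; simp [A, ne1, nx, abs_of_pos (cco_pos n), abs_of_nonneg h0]
  have nB : ∀ φ n, ‖B φ n‖ = cco n * x ^ n := by
    intro φ n; simp [B, ne2, nx, abs_of_pos (cco_pos n), abs_of_nonneg h0]
  have sA := summable_cco x h0 hx
  have sP : Summable fun p : ℕ × ℕ => (cco p.1 * x ^ p.1) * (cco p.2 * x ^ p.2) :=
    sA.mul_of_nonneg sA (fun n => by have := cco_pos n; positivity) (fun n => by have := cco_pos n; positivity)
  have H := intervalIntegral.hasSum_intervalIntegral_of_summable_norm (a := 0) (b := Real.pi)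
    (f := fun p : ℕ × ℕ => (⟨fun φ => A φ p.1 * B φ p.2, by fun_prop⟩ : C(ℝ, ℂ))) (by
      refine Summable.of_nonneg_of_le (fun _ => norm_nonneg _) (fun p => ?_) sP
      have := cco_pos p.1
      have := cco_pos p.2
      refine (ContinuousMap.norm_le _ (by positivity)).2 fun φ => ?_
      simp only [ContinuousMap.restrict_apply, ContinuousMap.coe_mk]
      rw [norm_mul, nA, nB])
  simp only [ContinuousMap.coe_mk] at H
  have e1 : ∀ φ : ℝ, ∑' p : ℕ × ℕ, A φ p.1 * B φ p.2 =
      ((1 / (1 + x) * (1 / √(1 - 4 * x / (1 + x)^2 * Real.sin φ ^ 2)) : ℝ) : ℂ) := by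
    intro φ
    rw [← norm_val x h0 hx, ← (hasSum_binom _ (by rw [norm_mul, nx, ne1]; linarith)).tsum_eq,
      ← (hasSum_binom _ (by rw [norm_mul, nx, ne2]; linarith)).tsum_eq,
      tsum_mul_tsum_of_summable_norm]
    · simpa only [← nA φ] using sA
    · simpa only [← nB φ] using sA
  have e2 : ∀ p : ℕ × ℕ, ∫ φ in (0:ℝ)..Real.pi, A φ p.1 * B φ p.2 =
      if p.1 = p.2 then ((Real.pi * (cco p.1 ^ 2 * (x^2) ^ p.1) : ℝ) : ℂ) else 0 := by
    intro p
    have : ∀ φ, A φ p.1 * B φ p.2 = (cco p.1 * cco p.2 * (-x : ℂ) ^ p.1 * (-x : ℂ) ^ p.2 : ℂ) *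
      (Complex.exp (2 * φ * Complex.I) ^ p.1 * Complex.exp (-(2 * φ * Complex.I)) ^ p.2) := by
      intro φ; simp only [A, B, mul_pow]; ring
    simp only [this]
    rw [intervalIntegral.integral_const_mul, exp_int]
    split_ifs with h
    · rw [← h]; push_cast
      have hm : (-x : ℂ) ^ p.1 * (-x : ℂ) ^ p.1 = ((x : ℂ) ^ 2) ^ p.1 := by
        rw [← mul_pow]; congr 1; ring
      linear_combination (cco p.1 : ℂ) * cco p.1 * Real.pi * hm
    · simp
  simp only [e1, e2] at H
  rw [intervalIntegral.integral_ofReal] at H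
  have H2 := (Function.Injective.hasSum_iff (g := fun n : ℕ => ((n, n) : ℕ × ℕ))
    (fun a b h => (Prod.ext_iff.1 h).1) (by
      rintro ⟨a, b⟩ h
      rw [if_neg]
      intro hab
      obtain rfl : a = b := hab
      exact h ⟨a, rfl⟩)).2 H
  simp only [Function.comp_def, if_true, Complex.hasSum_ofReal] at H2
  rw [← H2.tsum_eq, FF, ← tsum_mul_left]

lemma landen (x : ℝ) (h0 : 0 ≤ x) (hx : x < 1) : FF (4 * x / (1 + x)^2) = (1 + x) * FF (x^2) := by
  have h1 := int_two x h0 hx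
  have h2 := int_one (4 * x / (1+x)^2) (by positivity) (by
    rw [div_lt_one (by positivity)]; nlinarith [sq_pos_of_pos (sub_pos.2 hx)])
  rw [intervalIntegral.integral_const_mul, h2] at h1
  have := Real.pi_pos
  have hx1 : (1 + x) ≠ 0 := by positivity
  have h3 : Real.pi * FF (4 * x / (1 + x)^2) = Real.pi * ((1 + x) * FF (x^2)) := by
    calc _ = (1 + x) * (1 / (1 + x) * (Real.pi * FF (4 * x / (1 + x)^2))) := by field_simp
      _ = _ := by rw [h1]; ring
  exact mul_left_cancel₀ this.ne' h3

lemma FF_zero : FF 0 = 1 := by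
  unfold FF
  rw [tsum_eq_single 0]
  · simp [cco]
  · intro n hn; simp [hn]

lemma FF_cont : ContinuousAt FF 0 := by
  have : ContinuousOn FF (Set.Icc (-(1/2)) (1/2)) := by
    unfold FF
    refine continuousOn_tsum (u := fun n : ℕ => (1/2 : ℝ)^n) (fun n => by fun_prop)
      (summable_geometric_of_lt_one (by norm_num) (by norm_num)) ?_
    intro n x hx
    rw [norm_mul, norm_pow, norm_pow]
    have h1 : ‖cco n‖ ^ 2 ≤ 1 := by
      rw [Real.norm_of_nonneg (cco_pos n).le]; exact pow_le_one₀ (cco_pos n).le (cco_le_one n)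
    have h2 : ‖x‖ ≤ 1/2 := by rw [Real.norm_eq_abs, abs_le]; exact hx
    calc _ ≤ 1 * (1/2 : ℝ)^n := by gcongr
      _ = _ := one_mul _
  exact this.continuousAt (Icc_mem_nhds (by norm_num) (by norm_num))

lemma tsum_split {α β : Type*} (g1 g2 : α → β) (i1 : Function.Injective g1)
    (i2 : Function.Injective g2) (hc : IsCompl (Set.range g1) (Set.range g2)) (f : β → ℝ)
    (hf : Summable f) : ∑' b, f b = ∑' a, f (g1 a) + ∑' a, f (g2 a) := by
  have h1 := (hf.comp_injective i1).hasSum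
  have h2 := (hf.comp_injective i2).hasSum
  exact ((i1.hasSum_range_iff.2 h1).add_isCompl hc (i2.hasSum_range_iff.2 h2)).tsum_eq

lemma tsum_int_split (f : ℤ → ℝ) (hf : Summable f) :
    ∑' n, f n = ∑' n, f (2 * n) + ∑' n, f (2 * n + 1) := by
  refine tsum_split (fun n : ℤ => 2 * n) (fun n : ℤ => 2 * n + 1) (fun a b h => by simpa using h)
    (fun a b h => by simpa using h) ?_ f hf
  rw [isCompl_iff, disjoint_iff_inf_le, codisjoint_iff_le_sup]
  refine ⟨?_, ?_⟩
  · rintro x ⟨⟨a, ha⟩, ⟨b, hb⟩⟩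
    simp only at ha hb
    exact absurd (ha.trans hb.symm) (by omega)
  · rintro x -
    rcases Int.even_or_odd' x with ⟨k, h | h⟩
    · exact Or.inl ⟨k, h.symm⟩
    · exact Or.inr ⟨k, h.symm⟩

lemma tsum_int2_split (f : ℤ × ℤ → ℝ) (hf : Summable f) :
    ∑' p, f p = ∑' p : ℤ × ℤ, f (p.1 + p.2, p.1 - p.2)
      + ∑' p : ℤ × ℤ, f (p.1 + p.2 + 1, p.1 - p.2) := by
  refine tsum_split (fun p : ℤ × ℤ => (p.1 + p.2, p.1 - p.2))
    (fun p : ℤ × ℤ => (p.1 + p.2 + 1, p.1 - p.2)) ?_ ?_ ?_ f hf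
  · rintro ⟨a, b⟩ ⟨c, d⟩ h
    simp only [Prod.mk.injEq] at h ⊢
    omega
  · rintro ⟨a, b⟩ ⟨c, d⟩ h
    simp only [Prod.mk.injEq] at h ⊢
    omega
  rw [isCompl_iff, disjoint_iff_inf_le, codisjoint_iff_le_sup]
  refine ⟨?_, ?_⟩
  · rintro x ⟨⟨a, ha⟩, ⟨b, hb⟩⟩
    have h := ha.trans hb.symm
    simp only [Prod.mk.injEq] at h
    exact absurd h.1 (by omega)
  · rintro ⟨x, y⟩ -
    rcases Int.even_or_odd' (x + y) with ⟨k, h | h⟩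
    · exact Or.inl ⟨(k, x - k), by simp only [Prod.mk.injEq]; omega⟩
    · exact Or.inr ⟨(k, x - k - 1), by simp only [Prod.mk.injEq]; omega⟩

noncomputable def q3 (t : ℝ) (n : ℤ) : ℝ := Real.exp (-Real.pi * t * (n : ℝ) ^ 2)
noncomputable def q2 (t : ℝ) (n : ℤ) : ℝ := Real.exp (-Real.pi * t * ((n : ℝ) + 1/2) ^ 2)
noncomputable def sg (n : ℤ) : ℝ := (-1 : ℝ) ^ n
noncomputable def T3 (t : ℝ) : ℝ := ∑' n, q3 t n
noncomputable def T2 (t : ℝ) : ℝ := ∑' n, q2 t n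
noncomputable def T4 (t : ℝ) : ℝ := ∑' n, sg n * q3 t n

lemma sg_add (a b : ℤ) : sg (a + b) = sg a * sg b := zpow_add₀ (by norm_num) a b
lemma sg_neg (a : ℤ) : sg (-a) = sg a := by
  unfold sg; rw [zpow_neg, ← inv_zpow]; norm_num
lemma sg_one : sg 1 = -1 := by simp [sg]
lemma sg_two_mul (a : ℤ) : sg (2 * a) = 1 := by unfold sg; rw [zpow_mul]; norm_num
lemma sg_sq (a : ℤ) : sg a * sg a = 1 := by rw [← sg_add, ← two_mul, sg_two_mul]
lemma sg_abs (a : ℤ) : |sg a| = 1 := by simp [sg, abs_zpow]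
lemma sg_sub (a b : ℤ) : sg (a - b) = sg a * sg b := by rw [sub_eq_add_neg, sg_add, sg_neg]

lemma q3_pos (t : ℝ) (n : ℤ) : 0 < q3 t n := Real.exp_pos _
lemma q2_pos (t : ℝ) (n : ℤ) : 0 < q2 t n := Real.exp_pos _

lemma q3_eq_complex (t : ℝ) (n : ℤ) :
    (q3 t n : ℂ) = Complex.exp (Real.pi * Complex.I * (n : ℂ) ^ 2 * (Complex.I * t)) := by
  unfold q3
  push_cast
  congr 1
  linear_combination (-Real.pi * (n:ℂ)^2 * t : ℂ) * Complex.I_sq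

lemma hasSum_q3 (t : ℝ) (ht : 0 < t) : HasSum (fun n => (q3 t n : ℂ)) (jacobiTheta (Complex.I * t)) := by
  have h := hasSum_jacobiTheta₂_term 0 (τ := Complex.I * t) (by simpa using ht)
  rw [← jacobiTheta_eq_jacobiTheta₂] at h
  convert h using 1
  ext n
  rw [q3_eq_complex, jacobiTheta₂_term]
  simp

lemma s3 (t : ℝ) (ht : 0 < t) : Summable (q3 t) := by
  have := (hasSum_q3 t ht).summable
  exact_mod_cast this

lemma T3_complex (t : ℝ) (ht : 0 < t) : (T3 t : ℂ) = jacobiTheta (Complex.I * t) := by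
  rw [← (hasSum_q3 t ht).tsum_eq, T3, Complex.ofReal_tsum]

lemma q3_even (t : ℝ) (n : ℤ) : q3 t (2 * n) = q3 (4 * t) n := by
  unfold q3; congr 1; push_cast; ring
lemma q3_odd (t : ℝ) (n : ℤ) : q3 t (2 * n + 1) = q2 (4 * t) n := by
  unfold q3 q2; congr 1; push_cast; ring

lemma s2 (t : ℝ) (ht : 0 < t) : Summable (q2 t) := by
  have := (s3 (t/4) (by positivity)).comp_injective (i := fun n : ℤ => 2 * n + 1)
    (fun a b h => by simpa using h)
  refine this.congr fun n => ?_
  simp only [Function.comp, q3_odd]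
  congr 1; ring

lemma s4 (t : ℝ) (ht : 0 < t) : Summable (fun n => sg n * q3 t n) := by
  refine Summable.of_norm ?_
  simpa [sg_abs, abs_of_pos (q3_pos t _)] using s3 t ht

lemma T3_quarter (t : ℝ) (ht : 0 < t) : T3 t = T3 (4 * t) + T2 (4 * t) := by
  unfold T3 T2
  rw [tsum_int_split _ (s3 t ht)]
  simp only [q3_even, q3_odd]

lemma T4_eq (t : ℝ) (ht : 0 < t) : T4 t = T3 (4 * t) - T2 (4 * t) := by
  unfold T3 T2 T4
  rw [tsum_int_split _ (s4 t ht)]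
  simp only [q3_even, q3_odd, sg_add, sg_two_mul, sg_one, one_mul, neg_one_mul, tsum_neg]
  ring

lemma T3_pos (t : ℝ) (ht : 0 < t) : 0 < T3 t := (s3 t ht).tsum_pos (fun n => (q3_pos t n).le) 0 (q3_pos t 0)
lemma T2_pos (t : ℝ) (ht : 0 < t) : 0 < T2 t := (s2 t ht).tsum_pos (fun n => (q2_pos t n).le) 0 (q2_pos t 0)

lemma T3_inv (t : ℝ) (ht : 0 < t) : T3 t⁻¹ = √t * T3 t := by
  have h := Real.tsum_exp_neg_mul_int_sq ht
  rw [← Real.sqrt_eq_rpow] at h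
  have h1 : ∑' n : ℤ, Real.exp (-Real.pi * t * (n:ℝ)^2) = T3 t := rfl
  have h2 : ∑' n : ℤ, Real.exp (-Real.pi / t * (n:ℝ)^2) = T3 t⁻¹ := rfl
  rw [h1, h2] at h
  have := Real.sqrt_pos.2 ht
  rw [h]; field_simp

lemma T2_inv (t : ℝ) (ht : 0 < t) : T2 t⁻¹ = √t * T4 t := by
  have h := T3_quarter (4 * t)⁻¹ (by positivity)
  have e : 4 * (4 * t)⁻¹ = t⁻¹ := by field_simp
  rw [e, T3_inv _ (by positivity), T3_inv _ ht, Real.sqrt_mul (by norm_num),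
    show √(4:ℝ) = 2 by rw [show (4:ℝ) = 2^2 by norm_num]; exact Real.sqrt_sq (by norm_num)] at h
  rw [T4_eq t ht]
  linear_combination -h - √t * T3_quarter t ht

lemma T4_pos (t : ℝ) (ht : 0 < t) : 0 < T4 t := by
  have h := T2_inv t ht
  have h2 := T2_pos t⁻¹ (by positivity)
  rw [h] at h2
  exact pos_of_mul_pos_right h2 (Real.sqrt_nonneg t)

lemma tsum_prod (f g : ℤ → ℝ) (hf : Summable f) (hg : Summable g) :
    (∑' n, f n) * (∑' n, g n) = ∑' p : ℤ × ℤ, f p.1 * g p.2 :=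
  tsum_mul_tsum_of_summable_norm hf.norm hg.norm

lemma sum_prod (f g : ℤ → ℝ) (hf : Summable f) (hg : Summable g) :
    Summable (fun p : ℤ × ℤ => f p.1 * g p.2) :=
  summable_mul_of_summable_norm hf.norm hg.norm

lemma q3_mul_even (t : ℝ) (a b : ℤ) : q3 t (a + b) * q3 t (a - b) = q3 (2 * t) a * q3 (2 * t) b := by
  unfold q3; rw [← Real.exp_add, ← Real.exp_add]; congr 1; push_cast; ring
lemma q3_mul_odd (t : ℝ) (a b : ℤ) : q3 t (a + b + 1) * q3 t (a - b) = q2 (2 * t) a * q2 (2 * t) b := by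
  unfold q3 q2; rw [← Real.exp_add, ← Real.exp_add]; congr 1; push_cast; ring

lemma id1 (t : ℝ) (ht : 0 < t) : T3 t ^ 2 = T3 (2*t) ^ 2 + T2 (2*t) ^ 2 := by
  have h3 := s3 t ht
  have h3' := s3 (2*t) (by positivity)
  have h2' := s2 (2*t) (by positivity)
  unfold T3 T2
  rw [pow_two, pow_two, pow_two, tsum_prod _ _ h3 h3, tsum_prod _ _ h3' h3', tsum_prod _ _ h2' h2',
    tsum_int2_split _ (sum_prod _ _ h3 h3)]
  simp only [q3_mul_even, q3_mul_odd]

lemma id2 (t : ℝ) (ht : 0 < t) : T4 t ^ 2 = T3 (2*t) ^ 2 - T2 (2*t) ^ 2 := by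
  have h3 := s4 t ht
  have h3' := s3 (2*t) (by positivity)
  have h2' := s2 (2*t) (by positivity)
  unfold T3 T2 T4
  rw [pow_two, pow_two, pow_two, tsum_prod _ _ h3 h3, tsum_prod _ _ h3' h3', tsum_prod _ _ h2' h2',
    tsum_int2_split _ (sum_prod _ _ h3 h3), sub_eq_add_neg, ← tsum_neg]
  congr 1
  · refine tsum_congr fun p => ?_
    rw [← q3_mul_even, sg_add, sg_sub]
    linear_combination q3 t (p.1 + p.2) * q3 t (p.1 - p.2) * (sg p.2 * sg p.2 * sg_sq p.1 + sg_sq p.2)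
  · refine tsum_congr fun p => ?_
    rw [← q3_mul_odd, sg_add, sg_add, sg_sub, sg_one]
    linear_combination - q3 t (p.1 + p.2 + 1) * q3 t (p.1 - p.2) * (sg p.2 * sg p.2 * sg_sq p.1 + sg_sq p.2)

lemma odd_zero (t : ℝ) : ∑' n, sg n * q2 t n = 0 := by
  have h : ∑' n, sg n * q2 t n = ∑' n, -(sg n * q2 t n) := by
    rw [← (Equiv.subLeft (-1 : ℤ)).tsum_eq]
    refine tsum_congr fun n => ?_
    have e : q2 t (-1 - n) = q2 t n := by
      unfold q2; congr 1; push_cast; ring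
    simp only [Equiv.subLeft_apply]
    rw [e, sg_sub, sg_neg, sg_one]; ring
  rw [tsum_neg] at h
  linarith

lemma id3 (t : ℝ) (ht : 0 < t) : T3 t * T4 t = T4 (2*t) ^ 2 := by
  have h3 := s3 t ht
  have h4 := s4 t ht
  have h4' := s4 (2*t) (by positivity)
  have h2' : Summable (fun n => sg n * q2 (2*t) n) := by
    refine Summable.of_norm ?_
    simpa [sg_abs, abs_of_pos (q2_pos (2*t) _)] using s2 (2*t) (by positivity)
  have key : T3 t * T4 t = T4 (2*t) ^ 2 + (∑' n, sg n * q2 (2*t) n) ^ 2 := by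
    unfold T3 T4
    rw [pow_two, pow_two, tsum_prod _ _ h3 h4, tsum_prod _ _ h4' h4', tsum_prod _ _ h2' h2',
      tsum_int2_split _ (sum_prod _ _ h3 h4)]
    congr 1
    · refine tsum_congr fun p => ?_
      rw [sg_sub]
      linear_combination sg p.1 * sg p.2 * q3_mul_even t p.1 p.2
    · refine tsum_congr fun p => ?_
      rw [sg_sub]
      linear_combination sg p.1 * sg p.2 * q3_mul_odd t p.1 p.2
  rw [key, odd_zero]; ring

lemma jacobi4 (t : ℝ) (ht : 0 < t) : T3 t ^ 4 = T2 t ^ 4 + T4 t ^ 4 := by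
  have e : 2 * (t/2) = t := by ring
  have h1 := id1 (t/2) (by positivity)
  have h2 := id2 (t/2) (by positivity)
  have h3 := id3 (t/2) (by positivity)
  rw [e] at h1 h2 h3
  have : T3 t ^ 4 - T2 t ^ 4 = T4 t ^ 4 := by
    calc _ = (T3 t ^ 2 + T2 t ^ 2) * (T3 t ^ 2 - T2 t ^ 2) := by ring
      _ = (T3 (t/2) * T4 (t/2)) ^ 2 := by rw [← h1, ← h2]; ring
      _ = _ := by rw [h3]; ring
  linarith

noncomputable def lam (t : ℝ) : ℝ := T2 t ^ 4 / T3 t ^ 4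

lemma lam_inv (t : ℝ) (ht : 0 < t) : lam t⁻¹ = 1 - lam t := by
  have h3 := T3_pos t ht
  have hs : 0 < √t := Real.sqrt_pos.2 ht
  unfold lam
  rw [T2_inv t ht, T3_inv t ht]
  have := jacobi4 t ht
  field_simp
  linarith

lemma lam_step (t : ℝ) (ht : 0 < t) : FF (lam t) / T3 t ^ 2 = FF (lam (2*t)) / T3 (2*t) ^ 2 := by
  have ht2 : 0 < 2 * t := by positivity
  have p3 := T3_pos _ ht
  have p3' := T3_pos _ ht2
  have p2' := T2_pos _ ht2
  have p4 := T4_pos _ ht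
  have i1 := id1 t ht
  have i2 := id2 t ht
  have j := jacobi4 t ht
  set x := T2 (2*t) ^ 2 / T3 (2*t) ^ 2 with hx
  have x0 : 0 ≤ x := by positivity
  have x1 : x < 1 := by
    rw [hx, div_lt_one (by positivity)]
    nlinarith [pow_pos p4 2]
  have L := landen x x0 x1
  have e1 : x ^ 2 = lam (2*t) := by rw [hx, lam]; field_simp
  have e0 : 1 + x = T3 t ^ 2 / T3 (2*t) ^ 2 := by rw [hx, i1]; field_simp
  have e2 : 4 * x / (1 + x) ^ 2 = lam t := by
    have : T2 t ^ 4 = 4 * T3 (2*t) ^ 2 * T2 (2*t) ^ 2 := by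
      have a1 : T3 t ^ 4 = (T3 (2*t) ^ 2 + T2 (2*t) ^ 2) ^ 2 := by rw [← i1]; ring
      have a2 : T4 t ^ 4 = (T3 (2*t) ^ 2 - T2 (2*t) ^ 2) ^ 2 := by rw [← i2]; ring
      linarith
    rw [e0, hx, lam, this]
    field_simp
  rw [e1, e2, e0] at L
  rw [L]
  field_simp

open Filter Topology in
lemma T3_tendsto : Tendsto T3 atTop (𝓝 1) := by
  have h0 : Tendsto (fun t : ℝ => Real.exp (-Real.pi * t)) atTop (𝓝 0) := by
    refine Real.tendsto_exp_atBot.comp ?_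
    exact tendsto_id.const_mul_atTop_of_neg (by linarith [Real.pi_pos])
  have h1 : Tendsto (fun t : ℝ => 2 / (1 - Real.exp (-Real.pi * t)) * Real.exp (-Real.pi * t))
      atTop (𝓝 (2 / (1 - 0) * 0)) :=
    (tendsto_const_nhds.div (tendsto_const_nhds.sub h0) (by norm_num)).mul h0
  rw [mul_zero] at h1
  rw [tendsto_iff_norm_sub_tendsto_zero]
  refine squeeze_zero' (Eventually.of_forall fun _ => norm_nonneg _) ?_ h1
  filter_upwards [eventually_gt_atTop 0] with t ht
  have := norm_jacobiTheta_sub_one_le (τ := Complex.I * t) (by simpa using ht)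
  rw [← T3_complex t ht] at this
  simp only [Complex.mul_im, Complex.I_re, Complex.I_im, Complex.ofReal_re, Complex.ofReal_im,
    zero_mul, one_mul, zero_add] at this
  calc _ = ‖((T3 t : ℂ) - 1)‖ := by rw [← Complex.norm_real]; push_cast; rfl
    _ ≤ _ := this

open Filter Topology in
lemma T2_tendsto : Tendsto T2 atTop (𝓝 0) := by
  have h : Tendsto (fun t : ℝ => T3 (t/4) - T3 t) atTop (𝓝 (1 - 1)) :=
    (T3_tendsto.comp (tendsto_id.atTop_div_const (by norm_num))).sub T3_tendsto
  rw [sub_self] at h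
  refine h.congr' ?_
  filter_upwards [eventually_gt_atTop 0] with t ht
  have := T3_quarter (t/4) (by positivity)
  rw [show 4 * (t/4) = t by ring] at this
  linarith

open Filter Topology in
lemma lam_tendsto : Tendsto lam atTop (𝓝 0) := by
  have := (T2_tendsto.pow 4).div (T3_tendsto.pow 4) (by norm_num)
  rw [show (0:ℝ) = 0 ^ 4 / 1 ^ 4 by norm_num]
  exact this

open Filter Topology in
lemma FF_lam (t : ℝ) (ht : 0 < t) : FF (lam t) = T3 t ^ 2 := by
  have hn : ∀ n : ℕ, FF (lam t) / T3 t ^ 2 = FF (lam (2^n * t)) / T3 (2^n * t) ^ 2 := by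
    intro n
    induction n with
    | zero => simp
    | succ n ih =>
      rw [ih, lam_step _ (by positivity), ← mul_assoc, ← pow_succ']
  have h1 : Tendsto (fun t => FF (lam t) / T3 t ^ 2) atTop (𝓝 (FF 0 / 1 ^ 2)) :=
    (FF_cont.tendsto.comp lam_tendsto).div (T3_tendsto.pow 2) (by norm_num)
  have h2 : Tendsto (fun n : ℕ => (2:ℝ)^n * t) atTop atTop :=
    (tendsto_pow_atTop_atTop_of_one_lt (by norm_num)).atTop_mul_const ht
  have h3 := h1.comp h2
  have h4 : ((fun t => FF (lam t) / T3 t ^ 2) ∘ fun n : ℕ => (2:ℝ)^n * t)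
    = fun _ => FF (lam t) / T3 t ^ 2 := by
    ext n; exact (hn n).symm
  rw [h4, FF_zero] at h3
  have h5 := tendsto_nhds_unique h3 tendsto_const_nhds
  have := T3_pos t ht
  field_simp at h5
  linarith

lemma T3_cont : ContinuousOn T3 (Set.Ioi 0) := by
  intro t ht
  refine ContinuousAt.continuousWithinAt ?_
  have h : ContinuousAt (fun t : ℝ => (jacobiTheta (Complex.I * t)).re) t := by
    refine Complex.continuous_re.continuousAt.comp ?_
    exact ContinuousAt.comp (f := fun t : ℝ => Complex.I * (t : ℂ))
      (continuousAt_jacobiTheta (by simpa using ht)) (by fun_prop)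
  refine h.congr ?_
  filter_upwards [Ioi_mem_nhds ht] with s hs
  rw [← T3_complex s hs, Complex.ofReal_re]

lemma T2_cont : ContinuousOn T2 (Set.Ioi 0) := by
  have : ContinuousOn (fun t => T3 (t/4) - T3 t) (Set.Ioi 0) := by
    refine ContinuousOn.sub (T3_cont.comp (by fun_prop) ?_) T3_cont
    intro t ht
    have : 0 < t := ht
    show 0 < t/4
    positivity
  refine this.congr fun t ht => ?_
  have h : 0 < t := ht
  have := T3_quarter (t/4) (by positivity)
  rw [show 4 * (t/4) = t by ring] at this
  linarith

lemma lam_cont : ContinuousOn lam (Set.Ioi 0) :=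
  (T2_cont.pow 4).div (T3_cont.pow 4) fun t ht => (pow_pos (T3_pos t ht) 4).ne'

lemma lam_surj (z : ℝ) (h0 : 0 < z) (h1 : z < 1) : ∃ t, 0 < t ∧ lam t = z := by
  obtain ⟨t, h, ht⟩ := ((lam_tendsto.eventually_lt_const (lt_min h0 (sub_pos.2 h1))).and
    (Filter.eventually_gt_atTop 0)).exists
  have hi := lam_inv t ht
  have ht' : 0 < t⁻¹ := inv_pos.2 ht
  have a := lt_min_iff.1 h
  obtain ⟨s, hs, e⟩ := isPreconnected_Ioi.intermediate_value (s := Set.Ioi (0:ℝ)) ht ht' lam_cont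
    (show z ∈ Set.Icc (lam t) (lam t⁻¹) from ⟨a.1.le, by linarith [a.2]⟩)
  exact ⟨s, hs, e⟩

lemma modularLambda_eq (t : ℝ) : modularLambda (Complex.I * t) = (lam t : ℂ) := by
  have e3 : theta3 (Complex.I * t) = (T3 t : ℂ) := by
    rw [T3, Complex.ofReal_tsum]
    refine tsum_congr fun n => ?_
    rw [q3_eq_complex]; congr 1; ring
  have e2 : theta2 (Complex.I * t) = (T2 t : ℂ) := by
    rw [T2, Complex.ofReal_tsum]
    refine tsum_congr fun n => ?_
    unfold q2
    push_cast
    congr 1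
    linear_combination (Real.pi * ((n:ℂ) + 1/2)^2 * t : ℂ) * Complex.I_sq
  rw [modularLambda, e2, e3, lam]
  push_cast; rfl

lemma tau_eq (t : ℝ) (ht : 0 < t) :
    Complex.I * (ellipticK (1 - lam t) : ℂ) / (ellipticK (lam t) : ℂ) = Complex.I * t := by
  have h3 := T3_pos t ht
  have hs : √t ^ 2 = t := Real.sq_sqrt ht.le
  have e : ellipticK (1 - lam t) / ellipticK (lam t) = t := by
    rw [ellipticK_eq, ellipticK_eq, ← lam_inv t ht, FF_lam _ ht, FF_lam _ (inv_pos.2 ht),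
      T3_inv t ht, mul_pow, hs]
    have := Real.pi_pos
    field_simp
  rw [mul_div_assoc, ← Complex.ofReal_div, e]

/-- The mirror map `z ↦ τ = i·K(1−z)/K(z)` inverts the Hauptmodul `λ` of `Γ(2)`:
for `z ∈ (0,1)`, the point `τ` lies in the upper half-plane and `λ(τ) = z`. -/
theorem mirror_map_inverts_modularLambda (z : ℝ) (h0 : 0 < z) (h1 : z < 1) :
    0 < (Complex.I * (ellipticK (1 - z) : ℂ) / (ellipticK z : ℂ)).im ∧
    modularLambda (Complex.I * (ellipticK (1 - z) : ℂ) / (ellipticK z : ℂ)) =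
      (z : ℂ) := by
  obtain ⟨t, ht, rfl⟩ := lam_surj z h0 h1
  rw [tau_eq t ht]
  exact ⟨by simpa using ht, modularLambda_eq t⟩
end
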